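/- arXiv:1606.08321 — 4 statements merged into one kernel-verified Lean document; each statement's English description precedes it below -/
import Mathlib

section
/- Let (X_i)_{i≥1} be identically distributed nonnegative random variables such that X₁ is regularly varying with index α > 0 and the family is uniformly asymptotically independent. Fix n ≥ 1 and let ‖·‖ be any norm on ℝⁿ satisfying max_{1≤i≤n}|u_i| ≤ ‖u‖ ≤ ∑_{i=1}^n |u_i| for all u ∈ ℝⁿ. Then lim_{x→∞} P(‖(X₁,…,X_n)‖ > x) / (n·P(X₁ > x)) = 1. -/
open MeasureTheory ProbabilityTheory Filter

lemma aux_bonf {Ω : Type*} [MeasurableSpace Ω] (P : Measure Ω) [IsProbabilityMeasure P]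
    {ι : Type*} [DecidableEq ι] (A : ι → Set Ω) (hA : ∀ i, MeasurableSet (A i)) (F c : ℝ)
    (hc : 0 ≤ c) (hF : ∀ i, P.real (A i) = F)
    (hij : ∀ i j, i ≠ j → P.real (A i ∩ A j) ≤ c) (s : Finset ι) :
    (s.card : ℝ) * F - (s.card : ℝ) ^ 2 * c ≤ P.real (⋃ i ∈ s, A i) := by
  induction s using Finset.induction_on with
  | empty => simp
  | insert a s ha ih =>
    rw [Finset.card_insert_of_notMem ha, Finset.set_biUnion_insert]
    have h1 := measureReal_union_add_inter (μ := P) (s := A a) (t := ⋃ i ∈ s, A i)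
      (Finset.measurableSet_biUnion s (fun i _ => hA i)) (measure_ne_top _ _) (measure_ne_top _ _)
    have h2 : P.real (A a ∩ ⋃ i ∈ s, A i) ≤ s.card * c := by
      rw [Set.inter_iUnion₂]
      refine (measureReal_biUnion_finset_le s _).trans ?_
      refine (Finset.sum_le_card_nsmul s _ c ?_).trans (by simp)
      intro i hi
      exact hij a i (fun h => ha (h ▸ hi))
    rw [hF] at h1
    push_cast
    have h3 : (0 : ℝ) ≤ s.card * c := by positivity
    nlinarith

lemma aux_det {n : ℕ} (hn : 1 ≤ n) (y : Fin n → ℝ) (hy : ∀ i, 0 ≤ y i) (x δ : ℝ) (hx : 0 < x)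
    (hδ : 0 < δ) (h : x < ∑ i, y i) :
    (∃ i, (1 - δ) * x < y i) ∨ ∃ i j, i ≠ j ∧ δ / n * x < y i ∧ δ / n * x < y j := by
  by_contra! hcon
  obtain ⟨h1, h2⟩ := hcon
  haveI : Nonempty (Fin n) := ⟨⟨0, hn⟩⟩
  obtain ⟨m, hm⟩ := Finite.exists_max y
  have hn0 : (0 : ℝ) < n := by exact_mod_cast hn
  have h3 : ∀ j ∈ Finset.univ.erase m, y j ≤ δ / n * x := by
    intro j hj
    by_contra! hlt
    have := h2 m j (Finset.ne_of_mem_erase hj).symm (hlt.trans_le (hm j))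
    linarith
  have h4 := Finset.sum_le_card_nsmul _ _ _ h3
  have h5 : ((Finset.univ.erase m).card : ℝ) ≤ n := by
    have := Finset.card_le_univ (Finset.univ.erase m)
    rw [Fintype.card_fin] at this
    exact_mod_cast this
  rw [nsmul_eq_mul] at h4
  have h6 : ((Finset.univ.erase m).card : ℝ) * (δ / n * x) ≤ n * (δ / n * x) := by gcongr
  have h7 : (n : ℝ) * (δ / n * x) = δ * x := by field_simp
  have h8 := Finset.add_sum_erase Finset.univ y (Finset.mem_univ m)
  have := h1 m
  linarith

/-- Let `(X i)` for `i ≥ 1` be identically distributed nonnegative random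
variables such that `X 1` is regularly varying with index `α > 0` and the family is uniformly
asymptotically independent.  Fix `n ≥ 1` and let `nn` be any norm on `ℝⁿ` satisfying
`max_i |u i| ≤ nn u ≤ ∑ i |u i|`.  Then `P(nn (X 1, …, X n) > x) / (n · P(X 1 > x)) → 1`. -/
theorem norm_of_vector_tail_equivalent
    {Ω : Type*} [MeasurableSpace Ω] (P : Measure Ω) [IsProbabilityMeasure P]
    (X : ℕ → Ω → ℝ) (hXmeas : ∀ i, Measurable (X i))
    (hXnonneg : ∀ i ω, 0 ≤ X i ω)
    (hXid : ∀ i, 1 ≤ i → IdentDistrib (X i) (X 1) P P)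
    (α : ℝ) (hα : 0 < α)
    (hRVpos : ∀ x : ℝ, 0 < x → 0 < P {ω | x < X 1 ω})
    (hRV : ∀ t : ℝ, 0 < t →
      Tendsto (fun x => (P {ω | t * x < X 1 ω}).toReal / (P {ω | x < X 1 ω}).toReal)
        atTop (nhds (t ^ (-α))))
    (hUAI : ∀ ε : ℝ, 0 < ε → ∃ x₀ : ℝ, ∀ x ≥ x₀, ∀ i j : ℕ, 1 ≤ i → 1 ≤ j → i ≠ j →
      (P {ω | x < X i ω ∧ x < X j ω}).toReal ≤ ε * (P {ω | x < X 1 ω}).toReal)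
    (n : ℕ) (hn : 1 ≤ n)
    (nn : (Fin n → ℝ) → ℝ)
    (hnn_tri : ∀ u v, nn (u + v) ≤ nn u + nn v)
    (hnn_smul : ∀ (c : ℝ) u, nn (c • u) = |c| * nn u)
    (hnn_zero : ∀ u, nn u = 0 → u = 0)
    (hnn_lower : ∀ u, ∀ i, |u i| ≤ nn u)
    (hnn_upper : ∀ u, nn u ≤ ∑ i, |u i|) :
    Tendsto (fun x =>
        (P {ω | x < nn (fun i : Fin n => X ((i : ℕ) + 1) ω)}).toReal
          / ((n : ℝ) * (P {ω | x < X 1 ω}).toReal))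
      atTop (nhds 1) := by
  have hn0 : (0 : ℝ) < n := by exact_mod_cast hn
  set F : ℝ → ℝ := fun x => P.real {ω | x < X 1 ω} with hFdef
  have hFi : ∀ (i : Fin n) x, P.real {ω | x < X ((i : ℕ) + 1) ω} = F x := by
    intro i x
    have := (hXid (i + 1) (by omega)).measure_mem_eq (measurableSet_Ioi (a := x))
    simp only [hFdef, Measure.real]
    exact congrArg ENNReal.toReal this
  have hFpos : ∀ x, 0 < x → 0 < F x := fun x hx =>
    ENNReal.toReal_pos (hRVpos x hx).ne' (measure_ne_top _ _)
  set A : ℝ → Fin n → Set Ω := fun x i => {ω | x < X ((i : ℕ) + 1) ω} with hAdef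
  have hAm : ∀ x i, MeasurableSet (A x i) := fun x i => measurableSet_lt measurable_const (hXmeas _)
  have hAA : ∀ ε : ℝ, 0 < ε → ∀ᶠ x in atTop, ∀ i j : Fin n, i ≠ j →
      P.real (A x i ∩ A x j) ≤ ε * F x := by
    intro ε hε
    obtain ⟨x₀, h⟩ := hUAI ε hε
    filter_upwards [eventually_ge_atTop x₀] with x hx i j hij
    exact h x hx (i + 1) (j + 1) (by omega) (by omega) (fun h => hij (Fin.ext (by omega)))
  have hlow : ∀ ε : ℝ, 0 < ε → ∀ᶠ x in atTop, 1 - n * ε ≤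
      P.real {ω | x < nn (fun i : Fin n => X ((i : ℕ) + 1) ω)} / (n * F x) := by
    intro ε hε
    filter_upwards [hAA ε hε, eventually_gt_atTop 0] with x hx hx0
    have hF := hFpos x hx0
    have hb := aux_bonf P (A x) (hAm x) (F x) (ε * F x) (by positivity) (fun i => hFi i x) hx
      Finset.univ
    rw [Finset.card_univ, Fintype.card_fin] at hb
    rw [le_div_iff₀ (by positivity)]
    have hm : P.real (⋃ i ∈ Finset.univ, A x i) ≤
        P.real {ω | x < nn (fun i : Fin n => X ((i : ℕ) + 1) ω)} := by
      refine measureReal_mono ?_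
      intro ω hω
      simp only [Set.mem_iUnion, Finset.mem_univ, exists_true_left] at hω
      obtain ⟨i, hi⟩ := hω
      have h1 := hnn_lower (fun i : Fin n => X ((i : ℕ) + 1) ω) i
      exact lt_of_lt_of_le hi ((le_abs_self _).trans h1)
    nlinarith
  have hup : ∀ δ ε : ℝ, 0 < δ → 0 < ε → ∀ᶠ x in atTop,
      P.real {ω | x < nn (fun i : Fin n => X ((i : ℕ) + 1) ω)} / (n * F x) ≤
        F ((1 - δ) * x) / F x + n * ε * (F (δ / n * x) / F x) := by
    intro δ ε hδ hε
    have ht : Tendsto (fun x : ℝ => δ / n * x) atTop atTop :=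
      tendsto_id.const_mul_atTop (by positivity)
    filter_upwards [ht.eventually (hAA ε hε), eventually_gt_atTop 0] with x hx hx0
    have hF := hFpos x hx0
    have hsub : {ω | x < nn (fun i : Fin n => X ((i : ℕ) + 1) ω)} ⊆
        (⋃ i ∈ (Finset.univ : Finset (Fin n)), A ((1 - δ) * x) i) ∪
        ⋃ p ∈ (Finset.univ.filter (fun p : Fin n × Fin n => p.1 ≠ p.2)),
          (A (δ / n * x) p.1 ∩ A (δ / n * x) p.2) := by
      intro ω hω
      have h1 : x < ∑ i : Fin n, X ((i : ℕ) + 1) ω := by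
        refine lt_of_lt_of_le hω ((hnn_upper _).trans_eq ?_)
        exact Finset.sum_congr rfl (fun i _ => abs_of_nonneg (hXnonneg _ _))
      rcases aux_det hn _ (fun i => hXnonneg _ _) x δ hx0 hδ h1 with ⟨i, hi⟩ | ⟨i, j, hij, hi, hj⟩
      · left
        simp only [Set.mem_iUnion]
        exact ⟨i, Finset.mem_univ _, hi⟩
      · right
        simp only [Set.mem_iUnion]
        exact ⟨(i, j), by simpa using hij, hi, hj⟩
    have h2 := (measureReal_mono (μ := P) hsub).trans (measureReal_union_le _ _)
    have h3 : P.real (⋃ i ∈ (Finset.univ : Finset (Fin n)), A ((1 - δ) * x) i) ≤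
        n * F ((1 - δ) * x) := by
      refine (measureReal_biUnion_finset_le _ _).trans ?_
      refine (Finset.sum_le_card_nsmul _ _ (F ((1 - δ) * x)) (fun i _ => (hFi i _).le)).trans ?_
      simp
    have hF0 : 0 ≤ F (δ / n * x) := measureReal_nonneg
    have h4 : P.real (⋃ p ∈ (Finset.univ.filter (fun p : Fin n × Fin n => p.1 ≠ p.2)),
          (A (δ / n * x) p.1 ∩ A (δ / n * x) p.2)) ≤ n * n * (ε * F (δ / n * x)) := by
      refine (measureReal_biUnion_finset_le _ _).trans ?_
      refine (Finset.sum_le_card_nsmul _ _ (ε * F (δ / n * x)) ?_).trans ?_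
      · intro p hp
        exact hx p.1 p.2 (Finset.mem_filter.1 hp).2
      · rw [nsmul_eq_mul]
        refine mul_le_mul_of_nonneg_right ?_ (by positivity)
        have := Finset.card_le_univ (Finset.univ.filter (fun p : Fin n × Fin n => p.1 ≠ p.2))
        rw [Fintype.card_prod, Fintype.card_fin] at this
        exact_mod_cast this
    have h5 : F ((1 - δ) * x) / F x + n * ε * (F (δ / n * x) / F x) =
        (n * F ((1 - δ) * x) + n * n * (ε * F (δ / n * x))) / (n * F x) := by
      field_simp
    rw [h5]
    gcongr
    linarith
  change Tendsto (fun x => P.real {ω | x < nn (fun i : Fin n => X ((i : ℕ) + 1) ω)} / (n * F x))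
    atTop (nhds 1)
  rw [tendsto_order]
  constructor
  · intro a ha
    have he : 0 < (1 - a) / (2 * n) := by
      have : 0 < 1 - a := by linarith
      positivity
    filter_upwards [hlow _ he] with x hx
    refine lt_of_lt_of_le ?_ hx
    have : (n : ℝ) * ((1 - a) / (2 * n)) = (1 - a) / 2 := by field_simp
    rw [this]; linarith
  · intro b hb
    have hcont : Tendsto (fun δ : ℝ => (1 - δ) ^ (-α)) (nhdsWithin 0 (Set.Ioi 0)) (nhds 1) := by
      have hc : ContinuousAt (fun δ : ℝ => (1 - δ) ^ (-α)) 0 :=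
        ContinuousAt.rpow_const (by fun_prop) (Or.inl (by norm_num))
      have := hc.tendsto
      simp only [sub_zero, Real.one_rpow] at this
      exact this.mono_left nhdsWithin_le_nhds
    have hb' : 1 < (1 + b) / 2 := by linarith
    obtain ⟨δ, ⟨hδb, hδ0⟩, hδ1⟩ := ((hcont.eventually_lt_const hb').and
      (self_mem_nhdsWithin)).and (nhdsWithin_le_nhds (Iio_mem_nhds (zero_lt_one' ℝ))) |>.exists
    have hδ0 : 0 < δ := hδ0
    have hδ1 : δ < 1 := hδ1
    have h1 := (hRV (1 - δ) (by linarith)).eventually_lt_const hδb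
    set K := (δ / n) ^ (-α) + 1 with hK
    have hKpos : 0 < K := by positivity
    have h2 := (hRV (δ / n) (by positivity)).eventually_lt_const (lt_add_one _)
    have he : 0 < (b - 1) / (2 * n * K) := by
      have : 0 < b - 1 := by linarith
      positivity
    filter_upwards [h1, h2, hup δ _ hδ0 he] with x hx1 hx2 hx3
    have hx1 : F ((1 - δ) * x) / F x < (1 + b) / 2 := hx1
    have hx2 : F (δ / n * x) / F x < K := hx2
    have h6 : (n : ℝ) * ((b - 1) / (2 * n * K)) * (F (δ / n * x) / F x) ≤
      n * ((b - 1) / (2 * n * K)) * K := by gcongr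
    have h7 : (n : ℝ) * ((b - 1) / (2 * n * K)) * K = (b - 1) / 2 := by field_simp
    linarith
end

section
/- Let (X_i)_{i≥1} be identically distributed nonnegative random variables such that X₁ is regularly varying with index α > 0 and the family is uniformly asymptotically independent. Let N be a positive integer-valued random variable, independent of (X_i), with E[N^{2+α+ε}] < ∞ for some ε > 0. Let ‖·‖ be a norm on the space of finitely supported real sequences satisfying sup_i |u_i| ≤ ‖u‖ ≤ ∑_i |u_i|, and set X(N) = (X₁,…,X_N,0,0,…). Then lim_{x→∞} P(‖X(N)‖ > x) / P(X₁ > x) = E[N] > 0. -/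
open MeasureTheory ProbabilityTheory Filter

namespace RLN

lemma max_lower {Ω : Type*} [MeasurableSpace Ω] (P : Measure Ω) [IsProbabilityMeasure P]
    (Y : ℕ → Ω → ℝ) (hY : ∀ i, Measurable (Y i)) (F : ℝ → ℝ)
    (hF : ∀ i x, P.real {ω | x < Y i ω} = F x) (x c : ℝ)
    (hp : ∀ i j, i ≠ j → P.real {ω | x < Y i ω ∧ x < Y j ω} ≤ c) (hc : 0 ≤ c) (n : ℕ) :
    n * F x - (n : ℝ) ^ 2 * c ≤ P.real {ω | ∃ i ∈ Finset.range n, x < Y i ω} := by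
  induction n with
  | zero => simp
  | succ n ih =>
    have hA : MeasurableSet {ω | x < Y n ω} := measurableSet_lt measurable_const (hY n)
    have hU : {ω | ∃ i ∈ Finset.range (n+1), x < Y i ω}
        = {ω | ∃ i ∈ Finset.range n, x < Y i ω} ∪ {ω | x < Y n ω} := by
      ext ω
      simp only [Finset.mem_range, Set.mem_ofPred_eq, Set.mem_union]
      constructor
      · rintro ⟨i, hi, h⟩
        rcases Nat.lt_succ_iff_lt_or_eq.1 hi with h1 | rfl
        · exact Or.inl ⟨i, h1, h⟩
        · exact Or.inr h
      · rintro (⟨i, hi, h⟩ | h)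
        · exact ⟨i, by omega, h⟩
        · exact ⟨n, by omega, h⟩
    have h1 := measureReal_union_add_inter (μ := P) (s := {ω | ∃ i ∈ Finset.range n, x < Y i ω}) hA
    have h2 : P.real ({ω | ∃ i ∈ Finset.range n, x < Y i ω} ∩ {ω | x < Y n ω}) ≤ n * c := by
      have : {ω | ∃ i ∈ Finset.range n, x < Y i ω} ∩ {ω | x < Y n ω}
          ⊆ ⋃ i ∈ Finset.range n, {ω | x < Y i ω ∧ x < Y n ω} := by
        rintro ω ⟨⟨i, hi, h⟩, h'⟩
        exact Set.mem_biUnion (x := i) hi ⟨h, h'⟩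
      refine (measureReal_mono this (measure_ne_top _ _)).trans ((measureReal_biUnion_finset_le _ _).trans ?_)
      refine (Finset.sum_le_card_nsmul _ _ c ?_).trans ?_
      · intro i hi
        exact hp i n (by have := Finset.mem_range.1 hi; omega)
      · simp
    rw [hU]
    rw [hF] at h1
    push_cast
    nlinarith [mul_nonneg (Nat.cast_nonneg (α := ℝ) n) hc]

lemma max_upper {Ω : Type*} [MeasurableSpace Ω] (P : Measure Ω) [IsProbabilityMeasure P]
    (Y : ℕ → Ω → ℝ) (F : ℝ → ℝ)
    (hF : ∀ i x, P.real {ω | x < Y i ω} = F x) (x : ℝ) (n : ℕ) :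
    P.real {ω | ∃ i ∈ Finset.range n, x < Y i ω} ≤ n * F x := by
  have : {ω | ∃ i ∈ Finset.range n, x < Y i ω}
      ⊆ ⋃ i ∈ Finset.range n, {ω | x < Y i ω} := by
    rintro ω ⟨i, hi, h⟩
    exact Set.mem_biUnion (x := i) hi h
  refine (measureReal_mono this (measure_ne_top _ _)).trans ((measureReal_biUnion_finset_le _ _).trans ?_)
  simp [hF]

lemma sum_dom {Ω : Type*} [MeasurableSpace Ω] (P : Measure Ω) [IsProbabilityMeasure P]
    (Y : ℕ → Ω → ℝ) (F : ℝ → ℝ)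
    (hF : ∀ i x, P.real {ω | x < Y i ω} = F x) (x : ℝ) (hx : 0 < x) (n : ℕ) :
    P.real {ω | x < ∑ i ∈ Finset.range n, Y i ω} ≤ n * F (x / n) := by
  refine (measureReal_mono ?_).trans (max_upper P Y F hF (x / n) n)
  intro ω h
  simp only [Set.mem_ofPred_eq] at h ⊢
  by_contra! hcon
  have := Finset.sum_le_card_nsmul _ _ _ hcon
  rcases Nat.eq_zero_or_pos n with rfl | hn
  · simp at h; linarith
  · have hn' : (n : ℝ) ≠ 0 := by positivity
    simp at this
    field_simp at this
    linarith

lemma sum_upper {Ω : Type*} [MeasurableSpace Ω] (P : Measure Ω) [IsProbabilityMeasure P]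
    (Y : ℕ → Ω → ℝ) (F : ℝ → ℝ)
    (hF : ∀ i x, P.real {ω | x < Y i ω} = F x) (x c δ : ℝ) (hx : 0 < x) (n : ℕ)
    (hδ : 0 < δ) (hδ1 : δ < 1)
    (hp : ∀ i j, i ≠ j → P.real {ω | δ / (n + 1) * x < Y i ω ∧ δ / (n + 1) * x < Y j ω} ≤ c)
    (hc : 0 ≤ c) :
    P.real {ω | x < ∑ i ∈ Finset.range n, Y i ω} ≤ n * F ((1 - δ) * x) + (n : ℝ) ^ 2 * c := by
  have hsub : {ω | x < ∑ i ∈ Finset.range n, Y i ω} ⊆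
      {ω | ∃ i ∈ Finset.range n, (1 - δ) * x < Y i ω} ∪
      ⋃ i ∈ Finset.range n, ⋃ j ∈ (Finset.range n).erase i,
        {ω | δ / (n + 1) * x < Y i ω ∧ δ / (n + 1) * x < Y j ω} := by
    intro ω h
    simp only [Set.mem_ofPred_eq] at h
    by_cases hb : ∃ i ∈ Finset.range n, (1 - δ) * x < Y i ω
    · exact Or.inl hb
    right
    push Not at hb
    have hn1 : (0:ℝ) < n + 1 := by positivity
    have hy : 0 < δ / (n + 1) * x := by positivity
    have hny : (n:ℝ) * (δ / (n + 1) * x) ≤ δ * x := by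
      have : (n:ℝ) * (δ / (n + 1) * x) = (n / (n+1)) * (δ * x) := by field_simp
      rw [this]
      have : (n:ℝ) / (n+1) ≤ 1 := by rw [div_le_one hn1]; linarith
      nlinarith [mul_pos hδ hx]
    obtain ⟨i, hi, hYi⟩ : ∃ i ∈ Finset.range n, δ / (n + 1) * x < Y i ω := by
      by_contra! hcon
      have := Finset.sum_le_card_nsmul _ _ _ hcon
      simp at this
      nlinarith
    obtain ⟨j, hj, hYj⟩ : ∃ j ∈ (Finset.range n).erase i, δ / (n + 1) * x < Y j ω := by
      by_contra! hcon
      have h1 := Finset.sum_le_card_nsmul _ _ _ hcon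
      have h2 := Finset.add_sum_erase (Finset.range n) (fun i => Y i ω) hi
      have h3 : (((Finset.range n).erase i).card : ℝ) ≤ n := by
        have := Finset.card_erase_le (s := Finset.range n) (a := i)
        rw [Finset.card_range] at this
        exact_mod_cast this
      have h4 := hb i hi
      simp only [nsmul_eq_mul] at h1
      have h5 := mul_le_mul_of_nonneg_right h3 hy.le
      nlinarith
    exact Set.mem_biUnion (x := i) hi (Set.mem_biUnion (x := j) hj ⟨hYi, hYj⟩)
  refine (measureReal_mono hsub (measure_ne_top _ _)).trans ((measureReal_union_le _ _).trans ?_)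
  refine add_le_add (max_upper P Y F hF _ n) ?_
  refine (measureReal_biUnion_finset_le _ _).trans ?_
  refine (Finset.sum_le_card_nsmul _ _ (n * c) ?_).trans ?_
  · intro i hi
    refine (measureReal_biUnion_finset_le _ _).trans ?_
    refine (Finset.sum_le_card_nsmul _ _ c ?_).trans ?_
    · intro j hj
      exact hp i j (Finset.ne_of_mem_erase hj).symm
    · rw [nsmul_eq_mul]
      refine mul_le_mul_of_nonneg_right ?_ hc
      have := Finset.card_erase_le (s := Finset.range n) (a := i)
      rw [Finset.card_range] at this
      exact_mod_cast this
  · simp; exact le_of_eq (by ring)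

lemma max_tendsto {Ω : Type*} [MeasurableSpace Ω] (P : Measure Ω) [IsProbabilityMeasure P]
    (Y : ℕ → Ω → ℝ) (hY : ∀ i, Measurable (Y i)) (F : ℝ → ℝ)
    (hF : ∀ i x, P.real {ω | x < Y i ω} = F x) (hpos : ∀ x, 0 < x → 0 < F x)
    (hUAI : ∀ ε : ℝ, 0 < ε → ∃ x₀ : ℝ, ∀ x ≥ x₀, ∀ i j : ℕ, i ≠ j →
      P.real {ω | x < Y i ω ∧ x < Y j ω} ≤ ε * F x) (n : ℕ) :
    Tendsto (fun x => P.real {ω | ∃ i ∈ Finset.range n, x < Y i ω} / F x) atTop (nhds n) := by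
  rw [tendsto_order]
  constructor
  · intro a ha
    have hε : 0 < (n - a) / ((n:ℝ)^2 + 1) := div_pos (by linarith) (by positivity)
    obtain ⟨x₀, h0⟩ := hUAI _ hε
    filter_upwards [eventually_ge_atTop x₀, eventually_gt_atTop 0] with x hx hx0
    have hFx := hpos x hx0
    have := max_lower P Y hY F hF x _ (h0 x hx) (by positivity) n
    rw [lt_div_iff₀ hFx]
    refine lt_of_lt_of_le ?_ this
    have h2 : (n:ℝ)^2 * ((n - a) / ((n:ℝ)^2 + 1)) < n - a := by
      rw [mul_div_assoc', div_lt_iff₀ (by positivity)]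
      nlinarith
    nlinarith
  · intro a ha
    filter_upwards [eventually_gt_atTop 0] with x hx0
    have hFx := hpos x hx0
    rw [div_lt_iff₀ hFx]
    have := max_upper P Y F hF x n
    nlinarith

lemma max_le_sum {Ω : Type*} [MeasurableSpace Ω] (P : Measure Ω) [IsProbabilityMeasure P]
    (Y : ℕ → Ω → ℝ) (hY0 : ∀ i ω, 0 ≤ Y i ω) (x : ℝ) (n : ℕ) :
    P.real {ω | ∃ i ∈ Finset.range n, x < Y i ω} ≤
    P.real {ω | x < ∑ i ∈ Finset.range n, Y i ω} := by
  refine measureReal_mono ?_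
  rintro ω ⟨i, hi, h⟩
  exact h.trans_le (Finset.single_le_sum (f := fun i => Y i ω) (fun j _ => hY0 j ω) hi)

lemma sum_tendsto {Ω : Type*} [MeasurableSpace Ω] (P : Measure Ω) [IsProbabilityMeasure P]
    (Y : ℕ → Ω → ℝ) (hY : ∀ i, Measurable (Y i)) (hY0 : ∀ i ω, 0 ≤ Y i ω) (F : ℝ → ℝ)
    (hF : ∀ i x, P.real {ω | x < Y i ω} = F x) (hpos : ∀ x, 0 < x → 0 < F x)
    (α : ℝ) (hRV : ∀ t : ℝ, 0 < t →
      Tendsto (fun x => F (t * x) / F x) atTop (nhds (t ^ (-α))))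
    (hUAI : ∀ ε : ℝ, 0 < ε → ∃ x₀ : ℝ, ∀ x ≥ x₀, ∀ i j : ℕ, i ≠ j →
      P.real {ω | x < Y i ω ∧ x < Y j ω} ≤ ε * F x) (n : ℕ) :
    Tendsto (fun x => P.real {ω | x < ∑ i ∈ Finset.range n, Y i ω} / F x) atTop (nhds n) := by
  rw [tendsto_order]
  constructor
  · intro a ha
    filter_upwards [(tendsto_order.1 (max_tendsto P Y hY F hF hpos hUAI n)).1 a ha,
      eventually_gt_atTop 0] with x hx hx0
    exact hx.trans_le (div_le_div_of_nonneg_right (max_le_sum P Y hY0 x n) (hpos x hx0).le)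
  · intro a ha
    have t1 : Tendsto (fun δ : ℝ => (n:ℝ) * (1 - δ) ^ (-α)) (nhdsWithin 0 (Set.Ioi 0)) (nhds n) := by
      have : ContinuousAt (fun δ : ℝ => (n:ℝ) * (1 - δ) ^ (-α)) 0 := by
        refine continuousAt_const.mul (ContinuousAt.rpow_const ?_ (Or.inl (by norm_num)))
        fun_prop
      have h := this.tendsto
      simp at h
      exact h.mono_left nhdsWithin_le_nhds
    obtain ⟨δ, ⟨hδa, hδ1⟩, hδ0⟩ := ((((tendsto_order.1 t1).2 a ha).and
      (nhdsWithin_le_nhds (eventually_lt_nhds (zero_lt_one (α := ℝ))))).and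
        self_mem_nhdsWithin).exists
    have hδ0' : 0 < δ := hδ0
    have t2 : Tendsto (fun η : ℝ => (n:ℝ) * (1 - δ) ^ (-α) + (n:ℝ)^2 * (η * (δ/(n+1)) ^ (-α)))
        (nhdsWithin 0 (Set.Ioi 0)) (nhds ((n:ℝ) * (1 - δ) ^ (-α))) := by
      have : Continuous (fun η : ℝ => (n:ℝ) * (1 - δ) ^ (-α) + (n:ℝ)^2 * (η * (δ/(n+1)) ^ (-α))) := by
        fun_prop
      have h := this.tendsto 0
      simp only [zero_mul, mul_zero, add_zero] at h
      exact h.mono_left nhdsWithin_le_nhds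
    obtain ⟨η, hηa, hη0⟩ := (((tendsto_order.1 t2).2 a hδa).and self_mem_nhdsWithin).exists
    have hη0' : 0 < η := hη0
    have hd : 0 < δ / ((n:ℝ) + 1) := by positivity
    have t3 := ((hRV (1 - δ) (by linarith)).const_mul (n:ℝ)).add
      (((hRV _ hd).const_mul η).const_mul ((n:ℝ)^2))
    obtain ⟨x₀, h0⟩ := hUAI η hη0'
    filter_upwards [(tendsto_order.1 t3).2 a hηa, eventually_gt_atTop 0,
      (tendsto_id.const_mul_atTop hd).eventually_ge_atTop x₀] with x hx hx0 hx1
    refine lt_of_le_of_lt ?_ hx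
    have hFx := hpos x hx0
    have := sum_upper P Y F hF x (η * F (δ / ((n:ℝ) + 1) * x)) δ hx0 n hδ0' hδ1 (h0 _ hx1)
      (mul_nonneg hη0'.le (hpos _ (by positivity)).le)
    rw [div_le_iff₀ hFx]
    refine this.trans (le_of_eq ?_)
    field_simp

lemma potter (F : ℝ → ℝ) (hpos : ∀ x, 0 < x → 0 < F x) (hle : ∀ x, F x ≤ 1) (hanti : Antitone F)
    (α : ℝ) (hα : 0 < α) (hRV : ∀ t : ℝ, 0 < t →
      Tendsto (fun x => F (t * x) / F x) atTop (nhds (t ^ (-α)))) :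
    ∃ C > 0, ∃ x₀ > 0, ∀ x ≥ x₀, ∀ n : ℕ, 1 ≤ n → F (x / n) / F x ≤ C * (n:ℝ) ^ (α + 1) := by
  have h2 : (2:ℝ) ^ (-(α+1)) < 2 ^ (-α) :=
    Real.rpow_lt_rpow_of_exponent_lt (by norm_num) (by linarith)
  obtain ⟨y, hy⟩ := eventually_atTop.1 ((tendsto_order.1 (hRV 2 (by norm_num))).1 _ h2)
  set x₀ := max y 1 with hx₀
  have hx0 : 0 < x₀ := by positivity
  set q : ℝ := (2:ℝ) ^ (-(α+1)) with hq
  have hq0 : 0 < q := by positivity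
  have step : ∀ k : ℕ, ∀ x ≥ x₀, q ^ k * F x ≤ F (2 ^ k * x) := by
    intro k
    induction k with
    | zero => intro x _; simp
    | succ k ih =>
      intro x hx
      have hxp : 0 < x := hx0.trans_le hx
      have h1 : x ≤ 2 ^ k * x := le_mul_of_one_le_left hxp.le (one_le_pow₀ (by norm_num))
      have h3 := hy (2 ^ k * x) ((le_max_left _ _).trans (hx.le.trans h1))
      rw [lt_div_iff₀ (hpos _ (by positivity))] at h3
      have h4 := ih x hx
      calc q ^ (k+1) * F x = q * (q ^ k * F x) := by ring
        _ ≤ q * F (2 ^ k * x) := by gcongr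
        _ ≤ F (2 * (2 ^ k * x)) := h3.le
        _ = F (2 ^ (k+1) * x) := by congr 1; ring
  have key : ∀ n : ℕ, 1 ≤ n → ∀ x ≥ x₀, F x ≤ ((2:ℝ) * n) ^ (α + 1) * F (n * x) := by
    intro n hn x hx
    have hxp : 0 < x := hx0.trans_le hx
    have hn0 : (0:ℝ) < n := by exact_mod_cast hn
    set k := Nat.log 2 n + 1 with hk
    have k1 : (n:ℝ) ≤ 2 ^ k := by exact_mod_cast (Nat.lt_pow_succ_log_self (by norm_num) n).le
    have k2 : (2:ℝ) ^ k ≤ 2 * n := by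
      have := Nat.pow_log_le_self 2 (x := n) (by omega)
      have h : 2 ^ k ≤ 2 * n := by rw [hk, pow_succ]; omega
      exact_mod_cast h
    have h5 : F (2 ^ k * x) ≤ F (n * x) := hanti (by gcongr)
    have h6 := step k x hx
    have hqk : q ^ k * ((2:ℝ) ^ k) ^ (α + 1) = 1 := by
      rw [hq, ← Real.rpow_natCast, ← Real.rpow_natCast, ← Real.rpow_mul (by norm_num),
        ← Real.rpow_mul (by norm_num), ← Real.rpow_add (by norm_num)]
      convert Real.rpow_zero 2 using 2
      ring
    calc F x = ((2:ℝ) ^ k) ^ (α + 1) * (q ^ k * F x) := by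
          rw [← mul_assoc, mul_comm _ (q ^ k), hqk, one_mul]
      _ ≤ (2 * (n:ℝ)) ^ (α+1) * F (n * x) := by
          have := hpos x hxp
          refine mul_le_mul ?_ (h6.trans h5) (by positivity) (by positivity)
          exact Real.rpow_le_rpow (by positivity) k2 (by linarith)
  have hF0 := hpos _ hx0
  refine ⟨2 ^ (α+1) / F x₀, by positivity, x₀, hx0, fun x hx n hn => ?_⟩
  have hxp : 0 < x := hx0.trans_le hx
  have hn0 : (0:ℝ) < n := by exact_mod_cast hn
  have hFx := hpos x hxp
  have e : (2:ℝ) ^ (α+1) / F x₀ * (n:ℝ) ^ (α + 1) = (2 * (n:ℝ)) ^ (α+1) / F x₀ := by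
    rw [Real.mul_rpow (by norm_num) hn0.le]; ring
  rw [e, div_le_div_iff₀ hFx hF0]
  have hr : (0:ℝ) ≤ (2 * (n:ℝ)) ^ (α+1) := by positivity
  rcases le_total x₀ (x / n) with h | h
  · have h7 := key n hn _ h
    rw [mul_div_cancel₀ _ hn0.ne'] at h7
    have := hpos (x/n) (by positivity)
    nlinarith [hle x₀]
  · have h7 := key n hn x₀ le_rfl
    have h8 : F (n * x₀) ≤ F x := hanti (by rw [div_le_iff₀ hn0] at h; linarith)
    have := hle (x/n)
    nlinarith [mul_le_mul_of_nonneg_left h8 hr]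

lemma indep_integral {Ω : Type*} [MeasurableSpace Ω] (P : Measure Ω) [IsProbabilityMeasure P]
    (N : Ω → ℕ) (hN : Measurable N) (Z : Ω → ℕ → ℝ) (hZ : Measurable Z)
    (hind : IndepFun N Z P) (A : ℕ → Set (ℕ → ℝ)) (hA : ∀ n, MeasurableSet (A n)) :
    P.real {ω | Z ω ∈ A (N ω)} = ∫ ω, P.real {ω' | Z ω' ∈ A (N ω)} ∂P := by
  have hS : MeasurableSet {p : ℕ × (ℕ → ℝ) | p.2 ∈ A p.1} := by
    have : {p : ℕ × (ℕ → ℝ) | p.2 ∈ A p.1} = ⋃ n, ({n} ×ˢ A n) := by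
      ext ⟨a, b⟩; simp
    rw [this]
    exact MeasurableSet.iUnion fun n => (measurableSet_singleton n).prod (hA n)
  have h1 := (indepFun_iff_map_prod_eq_prod_map_map hN.aemeasurable hZ.aemeasurable).1 hind
  have h2 : P {ω | Z ω ∈ A (N ω)} = ∫⁻ ω, P {ω' | Z ω' ∈ A (N ω)} ∂P := by
    have : P {ω | Z ω ∈ A (N ω)} = (P.map (fun ω => (N ω, Z ω))) {p | p.2 ∈ A p.1} := by
      rw [Measure.map_apply (hN.prodMk hZ) hS]; rfl
    have : IsProbabilityMeasure (P.map Z) := Measure.isProbabilityMeasure_map hZ.aemeasurable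
    rw [‹P _ = _›, h1, Measure.prod_apply hS, lintegral_map (measurable_from_top) hN]
    refine lintegral_congr fun ω => ?_
    rw [Measure.map_apply hZ (measurable_prodMk_left hS)]; rfl
  rw [measureReal_def, h2]
  symm
  refine integral_toReal ?_ ?_
  · exact ((measurable_from_top (f := fun n => P {ω' | Z ω' ∈ A n})).comp hN).aemeasurable
  · exact ae_of_all _ fun ω => measure_lt_top _ _

lemma mix_tendsto {Ω : Type*} [MeasurableSpace Ω] (P : Measure Ω) [IsProbabilityMeasure P]
    (N : Ω → ℕ) (hN : Measurable N) (hNpos : ∀ ω, 1 ≤ N ω) (Z : Ω → ℕ → ℝ) (hZ : Measurable Z)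
    (hind : IndepFun N Z P) (A : ℝ → ℕ → Set (ℕ → ℝ)) (hA : ∀ x n, MeasurableSet (A x n))
    (F : ℝ → ℝ) (b : ℕ → ℝ) (hb : Integrable (fun ω => b (N ω)) P)
    (hdom : ∀ᶠ x in atTop, ∀ n, 1 ≤ n → |P.real {ω | Z ω ∈ A x n} / F x| ≤ b n)
    (hlim : ∀ n : ℕ, Tendsto (fun x => P.real {ω | Z ω ∈ A x n} / F x) atTop (nhds n)) :
    Tendsto (fun x => P.real {ω | Z ω ∈ A x (N ω)} / F x) atTop (nhds (∫ ω, (N ω : ℝ) ∂P)) := by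
  have e : ∀ x, P.real {ω | Z ω ∈ A x (N ω)} / F x
      = ∫ ω, P.real {ω' | Z ω' ∈ A x (N ω)} / F x ∂P := by
    intro x
    rw [indep_integral P N hN Z hZ hind (A x) (hA x), integral_div]
  simp_rw [e]
  refine tendsto_integral_filter_of_dominated_convergence (fun ω => b (N ω)) ?_ ?_ hb ?_
  · refine Eventually.of_forall fun x => Measurable.aestronglyMeasurable ?_
    exact (measurable_from_top (f := fun n => P.real {ω' | Z ω' ∈ A x n} / F x)).comp hN
  · filter_upwards [hdom] with x hx
    exact ae_of_all _ fun ω => hx _ (hNpos ω)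
  · exact ae_of_all _ fun ω => hlim (N ω)

end RLN

/-- Let `(X i)` for `i ≥ 1` be identically distributed nonnegative random
variables such that `X 1` is regularly varying with index `α > 0` and the family is uniformly
asymptotically independent.  Let `N` be a positive integer-valued random variable, independent of
`(X i)`, with `E[N^(2+α+ε)] < ∞` for some `ε > 0`.  Let `nn` be a norm on the space of finitely
supported real sequences satisfying `sup_i |u i| ≤ nn u ≤ ∑ i |u i|`, and let
`X(N) = (X 1, …, X N, 0, 0, …)` (coordinate `i`, `0`-based, carries `X (i+1)`).  Then
`P(nn (X(N)) > x) / P(X 1 > x) → E[N] > 0` as `x → ∞`. -/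
theorem random_length_norm_tail_equivalent
    {Ω : Type*} [MeasurableSpace Ω] (P : Measure Ω) [IsProbabilityMeasure P]
    (X : ℕ → Ω → ℝ) (hXmeas : ∀ i, Measurable (X i))
    (hXnonneg : ∀ i ω, 0 ≤ X i ω)
    (hXid : ∀ i, 1 ≤ i → IdentDistrib (X i) (X 1) P P)
    (α : ℝ) (hα : 0 < α)
    (hRVpos : ∀ x : ℝ, 0 < x → 0 < P {ω | x < X 1 ω})
    (hRV : ∀ t : ℝ, 0 < t →
      Tendsto (fun x => (P {ω | t * x < X 1 ω}).toReal / (P {ω | x < X 1 ω}).toReal)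
        atTop (nhds (t ^ (-α))))
    (hUAI : ∀ ε : ℝ, 0 < ε → ∃ x₀ : ℝ, ∀ x ≥ x₀, ∀ i j : ℕ, 1 ≤ i → 1 ≤ j → i ≠ j →
      (P {ω | x < X i ω ∧ x < X j ω}).toReal ≤ ε * (P {ω | x < X 1 ω}).toReal)
    (N : Ω → ℕ) (hNmeas : Measurable N) (hNpos : ∀ ω, 1 ≤ N ω)
    (hNindep : IndepFun N (fun ω => fun i : ℕ => X i ω) P)
    (hNmom : ∃ ε : ℝ, 0 < ε ∧
      ∫⁻ ω, ENNReal.ofReal ((N ω : ℝ) ^ ((2 : ℝ) + α + ε)) ∂P < ⊤)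
    (nn : (ℕ → ℝ) → ℝ)
    (hnn_tri : ∀ u v : ℕ → ℝ, (Function.support u).Finite → (Function.support v).Finite →
      nn (u + v) ≤ nn u + nn v)
    (hnn_smul : ∀ (c : ℝ) (u : ℕ → ℝ), (Function.support u).Finite →
      nn (c • u) = |c| * nn u)
    (hnn_zero : ∀ u : ℕ → ℝ, (Function.support u).Finite → nn u = 0 → u = 0)
    (hnn_lower : ∀ u : ℕ → ℝ, (Function.support u).Finite → ∀ i, |u i| ≤ nn u)
    (hnn_upper : ∀ u : ℕ → ℝ, (Function.support u).Finite → nn u ≤ ∑' i, |u i|) :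
    Tendsto (fun x =>
        (P {ω | x < nn (fun i => if i + 1 ≤ N ω then X (i + 1) ω else 0)}).toReal
          / (P {ω | x < X 1 ω}).toReal)
      atTop (nhds (∫ ω, (N ω : ℝ) ∂P)) ∧
    0 < ∫ ω, (N ω : ℝ) ∂P := by
  obtain ⟨ε, hε, hmom⟩ := hNmom
  set F : ℝ → ℝ := fun x => P.real {ω | x < X 1 ω} with hFdef
  set Y : ℕ → Ω → ℝ := fun i => X (i + 1) with hYdef
  have hY : ∀ i, Measurable (Y i) := fun i => hXmeas _
  have hY0 : ∀ i ω, 0 ≤ Y i ω := fun i ω => hXnonneg _ _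
  have hF : ∀ i x, P.real {ω | x < Y i ω} = F x := by
    intro i x
    have := (hXid (i + 1) (by omega)).measure_mem_eq (measurableSet_Ioi (a := x))
    simp only [hFdef, measureReal_def]
    exact congrArg ENNReal.toReal this
  have hpos : ∀ x, 0 < x → 0 < F x := fun x hx =>
    ENNReal.toReal_pos (hRVpos x hx).ne' (measure_ne_top _ _)
  have hle : ∀ x, F x ≤ 1 := fun x => measureReal_le_one
  have hanti : Antitone F := fun a b hab => measureReal_mono fun ω h => lt_of_le_of_lt hab h
  have hUAI' : ∀ ε : ℝ, 0 < ε → ∃ x₀ : ℝ, ∀ x ≥ x₀, ∀ i j : ℕ, i ≠ j →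
      P.real {ω | x < Y i ω ∧ x < Y j ω} ≤ ε * F x := by
    intro e he
    obtain ⟨x₀, h⟩ := hUAI e he
    exact ⟨x₀, fun x hx i j hij => h x hx (i+1) (j+1) (by omega) (by omega) (by omega)⟩
  have hmomI : Integrable (fun ω => (N ω : ℝ) ^ ((2 : ℝ) + α + ε)) P := by
    refine ⟨Measurable.aestronglyMeasurable ?_, ?_⟩
    · exact (measurable_from_top (f := fun n : ℕ => (n : ℝ) ^ ((2 : ℝ) + α + ε))).comp hNmeas
    · rw [hasFiniteIntegral_iff_ofReal (ae_of_all _ fun ω => by positivity)]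
      exact hmom
  have hN1 : ∀ ω, (1 : ℝ) ≤ N ω := fun ω => by exact_mod_cast hNpos ω
  have hNI : Integrable (fun ω => (N ω : ℝ)) P := by
    refine hmomI.mono' (Measurable.aestronglyMeasurable ?_) (ae_of_all _ fun ω => ?_)
    · exact (measurable_from_top (f := fun n : ℕ => (n : ℝ))).comp hNmeas
    · rw [Real.norm_of_nonneg (by positivity)]
      exact Real.self_le_rpow_of_one_le (hN1 ω) (by linarith)
  have hEpos : 0 < ∫ ω, (N ω : ℝ) ∂P := by
    have := integral_mono (integrable_const (1:ℝ)) hNI hN1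
    simp at this
    linarith
  refine ⟨?_, hEpos⟩
  obtain ⟨C, hC, x₀, hx₀, hpot⟩ := RLN.potter F hpos hle hanti α hα hRV
  set b : ℕ → ℝ := fun n => n * (C * (n:ℝ) ^ (α + 1)) with hb
  have hbI : Integrable (fun ω => b (N ω)) P := by
    refine (hmomI.const_mul C).mono' (Measurable.aestronglyMeasurable ?_) (ae_of_all _ fun ω => ?_)
    · exact (measurable_from_top (f := b)).comp hNmeas
    · have h0 : (0:ℝ) < N ω := by linarith [hN1 ω]
      rw [Real.norm_of_nonneg (by positivity)]
      have : b (N ω) = C * (N ω : ℝ) ^ ((2:ℝ) + α) := by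
        have : (2:ℝ) + α = α + 1 + 1 := by ring
        rw [this, Real.rpow_add_one h0.ne']
        simp only [hb]; ring
      rw [this]
      exact mul_le_mul_of_nonneg_left
        (Real.rpow_le_rpow_of_exponent_le (hN1 ω) (by linarith)) hC.le
  have hsumdom : ∀ x ≥ x₀, ∀ n : ℕ, 1 ≤ n →
      P.real {ω | x < ∑ i ∈ Finset.range n, Y i ω} / F x ≤ b n := by
    intro x hx n hn
    have hxp : 0 < x := hx₀.trans_le hx
    have h1 := RLN.sum_dom P Y F hF x hxp n
    have h2 := hpot x hx n hn
    calc _ ≤ n * F (x / n) / F x := div_le_div_of_nonneg_right h1 (hpos x hxp).le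
      _ = n * (F (x / n) / F x) := by ring
      _ ≤ b n := mul_le_mul_of_nonneg_left h2 (by positivity)
  have hZ : Measurable (fun ω => fun i : ℕ => X i ω) := measurable_pi_lambda _ hXmeas
  have hsum := RLN.mix_tendsto P N hNmeas hNpos _ hZ hNindep
    (fun x n => {z | x < ∑ i ∈ Finset.range n, z (i + 1)})
    (fun x n => measurableSet_lt measurable_const
      (Finset.measurable_sum _ fun i _ => measurable_pi_apply _)) F b hbI
    (by
      filter_upwards [eventually_ge_atTop x₀] with x hx n hn
      rw [abs_of_nonneg (div_nonneg measureReal_nonneg (hpos x (hx₀.trans_le hx)).le)]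
      exact hsumdom x hx n hn)
    (fun n => RLN.sum_tendsto P Y hY hY0 F hF hpos α hRV hUAI' n)
  have hmax := RLN.mix_tendsto P N hNmeas hNpos _ hZ hNindep
    (fun x n => {z | ∃ i ∈ Finset.range n, x < z (i + 1)})
    (fun x n => by
      have : {z : ℕ → ℝ | ∃ i ∈ Finset.range n, x < z (i + 1)}
          = ⋃ i ∈ Finset.range n, {z | x < z (i + 1)} := by
        ext z; simp
      rw [this]
      exact Finset.measurableSet_biUnion _ fun i _ =>
        measurableSet_lt measurable_const (measurable_pi_apply _)) F b hbI
    (by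
      filter_upwards [eventually_ge_atTop x₀] with x hx n hn
      have hFx := (hpos x (hx₀.trans_le hx)).le
      rw [abs_of_nonneg (div_nonneg measureReal_nonneg hFx)]
      exact (div_le_div_of_nonneg_right (RLN.max_le_sum P Y hY0 x n) hFx).trans
        (hsumdom x hx n hn))
    (fun n => RLN.max_tendsto P Y hY F hF hpos hUAI' n)
  have hfin : ∀ ω, (Function.support
      (fun i => if i + 1 ≤ N ω then X (i + 1) ω else 0)).Finite := by
    intro ω
    refine (Finset.range (N ω)).finite_toSet.subset fun i hi => ?_
    simp only [Function.mem_support, ne_eq, ite_eq_right_iff, not_forall] at hi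
    simpa [Nat.succ_le_iff] using hi.1
  refine tendsto_of_tendsto_of_tendsto_of_le_of_le' hmax hsum ?_ ?_
  · filter_upwards [eventually_gt_atTop 0] with x hx
    refine div_le_div_of_nonneg_right (measureReal_mono ?_) (hpos x hx).le
    rintro ω ⟨i, hi, h⟩
    have h1 := hnn_lower _ (hfin ω) i
    have hi' : i + 1 ≤ N ω := Finset.mem_range.1 hi
    simp only [hi', if_true] at h1
    exact lt_of_lt_of_le h ((le_abs_self _).trans h1)
  · filter_upwards [eventually_gt_atTop 0] with x hx
    refine div_le_div_of_nonneg_right (measureReal_mono ?_) (hpos x hx).le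
    intro ω h
    have h1 := hnn_upper _ (hfin ω)
    rw [tsum_eq_sum (s := Finset.range (N ω)) (by
      intro i hi
      have : ¬ (i + 1 ≤ N ω) := by simpa [Nat.succ_le_iff] using hi
      simp [this])] at h1
    have h2 : ∑ i ∈ Finset.range (N ω), |if i + 1 ≤ N ω then X (i + 1) ω else 0|
        = ∑ i ∈ Finset.range (N ω), X (i + 1) ω := by
      refine Finset.sum_congr rfl fun i hi => ?_
      have hi' : i + 1 ≤ N ω := Finset.mem_range.1 hi
      rw [if_pos hi', abs_of_nonneg (hXnonneg _ _)]
    rw [h2] at h1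
    exact lt_of_lt_of_le h h1
end

section
/- Let (X_i)_{i≥1} be identically distributed nonnegative random variables such that X₁ is regularly varying with index α > 0 and the family is uniformly asymptotically independent. Let N be a positive integer-valued random variable, independent of (X_i), with E[N^{2+α+ε}] < ∞ for some ε > 0. Let ‖·‖ be a norm on the space of finitely supported real sequences satisfying sup_i |u_i| ≤ ‖u‖ ≤ ∑_i |u_i|, set X(N) = (X₁,…,X_N,0,0,…), and let e_j denote the j-th canonical basis sequence. Then for every j ≥ 1 and every ε' ∈ (0,1/2), lim_{x→∞} P( ‖ X(N)/‖X(N)‖ − e_j ‖ < ε' | ‖X(N)‖ > x ) = P(N ≥ j) / E[N]. In particular the spectral measure of X(N) is concentrated on {e_j : j ≥ 1} with P(Θ(N) = e_j) = P(N ≥ j)/E[N]. -/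
open MeasureTheory ProbabilityTheory Filter

structure NH (nn : (ℕ → ℝ) → ℝ) : Prop where
  tri : ∀ u v : ℕ → ℝ, (Function.support u).Finite → (Function.support v).Finite →
      nn (u + v) ≤ nn u + nn v
  smul : ∀ (c : ℝ) (u : ℕ → ℝ), (Function.support u).Finite →
      nn (c • u) = |c| * nn u
  lower : ∀ u : ℕ → ℝ, (Function.support u).Finite → ∀ i, |u i| ≤ nn u
  upper : ∀ u : ℕ → ℝ, (Function.support u).Finite → nn u ≤ ∑' i, |u i|

def tr (n : ℕ) (w : ℕ → ℝ) : ℕ → ℝ := fun i => if i + 1 ≤ n then w (i + 1) else 0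
def ee (j : ℕ) : ℕ → ℝ := fun i => if i + 1 = j then 1 else 0
def Bset (nn : (ℕ → ℝ) → ℝ) (n : ℕ) (x : ℝ) : Set (ℕ → ℝ) := {w | x < nn (tr n w)}
def Aset (nn : (ℕ → ℝ) → ℝ) (j : ℕ) (ε : ℝ) (n : ℕ) (x : ℝ) : Set (ℕ → ℝ) :=
  {w | nn (fun i => tr n w i / nn (tr n w) - ee j i) < ε ∧ x < nn (tr n w)}
def Dset (n : ℕ) (y : ℝ) : Set (ℕ → ℝ) :=
  {w | ∃ i ∈ Finset.Icc 1 n, ∃ k ∈ Finset.Icc 1 n, i ≠ k ∧ y < w i ∧ y < w k}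

lemma fin_supp {u : ℕ → ℝ} (m : ℕ) (h : ∀ i, m ≤ i → u i = 0) : (Function.support u).Finite := by
  refine (Set.finite_lt_nat m).subset fun i hi => ?_
  by_contra hc
  exact hi (h i (not_lt.1 hc))

lemma tr_fin (n : ℕ) (w : ℕ → ℝ) : (Function.support (tr n w)).Finite :=
  fin_supp n fun i hi => by simp [tr]; omega

lemma ee_fin (j : ℕ) : (Function.support (ee j)).Finite :=
  fin_supp j fun i hi => by simp [ee]; omega

lemma fin_smul (c : ℝ) {u : ℕ → ℝ} (h : (Function.support u).Finite) :
    (Function.support (c • u)).Finite := h.subset (Function.support_const_smul_subset c u)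

lemma fin_add {u v : ℕ → ℝ} (h : (Function.support u).Finite) (h' : (Function.support v).Finite) :
    (Function.support (u + v)).Finite := (h.union h').subset (Function.support_add u v)

section
variable {nn : (ℕ → ℝ) → ℝ}

lemma NH.sum_le (H : NH nn) {u : ℕ → ℝ} (m : ℕ) (h : ∀ i, m ≤ i → u i = 0) :
    nn u ≤ ∑ i ∈ Finset.range m, |u i| := by
  refine (H.upper u (fin_supp m h)).trans_eq (tsum_eq_sum fun i hi => ?_)
  rw [h i (by simpa using hi), abs_zero]

lemma NH.nonneg (H : NH nn) {u : ℕ → ℝ} (h : (Function.support u).Finite) : 0 ≤ nn u :=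
  (abs_nonneg _).trans (H.lower u h 0)

lemma NH.ee_le (H : NH nn) (j : ℕ) : nn (ee j) ≤ 1 := by
  refine (H.sum_le j fun i hi => by simp [ee]; omega).trans ?_
  rcases j with _ | j
  · simp
  · rw [Finset.sum_eq_single j] <;> simp [ee]

/-- measurability -/
lemma NH.meas (H : NH nn) (m : ℕ) (g : (ℕ → ℝ) → (ℕ → ℝ)) (hg : ∀ i, Measurable fun w => g w i)
    (h0 : ∀ w i, m ≤ i → g w i = 0) : Measurable fun w => nn (g w) := by
  let E : (Fin m → ℝ) → (ℕ → ℝ) := fun v i => if h : i < m then v ⟨i, h⟩ else 0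
  have hE : ∀ v i, m ≤ i → E v i = 0 := fun v i hi => by simp [E]; omega
  have key : ∀ v v', nn (E v) ≤ nn (E v') + m * dist v v' := by
    intro v v'
    have e : E v = E v' + (E v - E v') := by abel
    have h1 : nn (E v) ≤ nn (E v') + nn (E v - E v') := by
      conv_lhs => rw [e]
      exact H.tri _ _ (fin_supp m (hE _)) (fin_supp m fun i hi => by simp [hE _ _ hi])
    have h2 : nn (E v - E v') ≤ m * dist v v' := by
      refine (H.sum_le m fun i hi => by simp [hE _ _ hi]).trans ?_
      have : ∑ i ∈ Finset.range m, |(E v - E v') i| ≤ ∑ i ∈ Finset.range m, dist v v' := by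
        refine Finset.sum_le_sum fun i hi => ?_
        have hi' := Finset.mem_range.1 hi
        simp only [E, Pi.sub_apply, hi', dif_pos]
        exact dist_le_pi_dist v v' ⟨i, hi'⟩
      simpa using this
    linarith
  have hc : Continuous fun v => nn (E v) := by
    refine (LipschitzWith.of_le_add_mul (m : NNReal) fun v v' => ?_).continuous
    simpa using key v v'
  have : (fun w => nn (g w)) = (fun v => nn (E v)) ∘ fun w (i : Fin m) => g w i := by
    funext w
    simp only [Function.comp]
    congr 1
    funext i
    by_cases hi : i < m
    · simp [E, hi]
    · simp [E, hi, h0 w i (not_lt.1 hi)]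
  rw [this]
  exact hc.measurable.comp (measurable_pi_lambda _ fun i => hg i)

lemma tr_meas (n i : ℕ) : Measurable fun w => tr n w i := by
  unfold tr
  split_ifs
  · exact measurable_pi_apply _
  · exact measurable_const

lemma NH.meas_tr (H : NH nn) (n : ℕ) : Measurable fun w => nn (tr n w) :=
  H.meas n _ (tr_meas n) fun w i hi => by simp [tr]; omega

lemma NH.measB (H : NH nn) (n : ℕ) (x : ℝ) : MeasurableSet (Bset nn n x) :=
  measurableSet_lt measurable_const (H.meas_tr n)

lemma NH.measA (H : NH nn) (j : ℕ) (ε : ℝ) (n : ℕ) (x : ℝ) : MeasurableSet (Aset nn j ε n x) := by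
  refine (measurableSet_lt (H.meas (max n j) _ (fun i => ?_) fun w i hi => ?_)
    measurable_const).inter (H.measB n x)
  · exact ((tr_meas n i).div (H.meas_tr n)).sub measurable_const
  · have h1 : tr n w i = 0 := by simp [tr]; omega
    have h2 : ee j i = 0 := by simp [ee]; omega
    simp [h1, h2]

lemma NH.core (H : NH nn) {n j : ℕ} {w : ℕ → ℝ} {h : ℝ} (hw : ∀ i, 0 ≤ w i) (hh : 0 ≤ h)
    (hj : 1 ≤ j) (hjn : j ≤ n)
    (hi : ∀ i, 1 ≤ i → i ≤ n → i ≠ j → w i ≤ h) : nn (tr n w + (-w j) • ee j) ≤ n * h := by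
  have hz : ∀ i, n ≤ i → (tr n w + (-w j) • ee j) i = 0 := by
    intro i hi
    have h1 : tr n w i = 0 := by simp [tr]; omega
    have h2 : ee j i = 0 := by simp [ee]; omega
    simp [h1, h2]
  refine (H.sum_le n hz).trans ?_
  have : ∑ i ∈ Finset.range n, |(tr n w + (-w j) • ee j) i| ≤ ∑ i ∈ Finset.range n, h := by
    refine Finset.sum_le_sum fun i hin => ?_
    have hin' := Finset.mem_range.1 hin
    have h1 : tr n w i = w (i+1) := by simp [tr]; omega
    by_cases hij : i + 1 = j
    · simp [h1, ee, hij, hh]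
    · simp only [Pi.add_apply, h1, Pi.smul_apply, ee, hij, if_false, smul_zero, add_zero]
      rw [abs_of_nonneg (hw _)]
      exact hi _ (by omega) (by omega) hij
  simpa using this

lemma NH.le_nn (H : NH nn) {n j : ℕ} {w : ℕ → ℝ} (hj : 1 ≤ j) (hjn : j ≤ n) :
    w j ≤ nn (tr n w) := by
  have := H.lower (tr n w) (tr_fin n w) (j-1)
  have e : tr n w (j-1) = w j := by
    simp [tr, Nat.sub_add_cancel hj, hjn]
  rw [e] at this
  exact (le_abs_self _).trans this

lemma NH.nn_le (H : NH nn) {n j : ℕ} {w : ℕ → ℝ} {h : ℝ} (hw : ∀ i, 0 ≤ w i) (hh : 0 ≤ h)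
    (hj : 1 ≤ j) (hjn : j ≤ n)
    (hi : ∀ i, 1 ≤ i → i ≤ n → i ≠ j → w i ≤ h) : nn (tr n w) ≤ w j + n * h := by
  have h1 := H.core hw hh hj hjn hi
  have e : tr n w = (tr n w + (-w j) • ee j) + (w j) • ee j := by
    rw [add_assoc, ← add_smul]; simp
  have h2 := H.tri (tr n w + (-w j) • ee j) ((w j) • ee j)
    (fin_add (tr_fin _ _) (fin_smul _ (ee_fin _))) (fin_smul _ (ee_fin _))
  rw [← e, H.smul _ _ (ee_fin _), abs_of_nonneg (hw j)] at h2
  have := mul_le_of_le_one_right (hw j) (H.ee_le j)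
  linarith

lemma NH.close (H : NH nn) {n j : ℕ} {w : ℕ → ℝ} {h : ℝ} (hw : ∀ i, 0 ≤ w i) (hh : 0 ≤ h)
    (hj : 1 ≤ j) (hjn : j ≤ n)
    (hi : ∀ i, 1 ≤ i → i ≤ n → i ≠ j → w i ≤ h) (hs : 0 < nn (tr n w)) :
    nn (fun i => tr n w i / nn (tr n w) - ee j i) ≤ 2 * n * h / nn (tr n w) := by
  have h1 := H.core hw hh hj hjn hi
  have h2 := H.nn_le hw hh hj hjn hi
  have h3 := H.le_nn (w := w) hj hjn
  set s := nn (tr n w) with hsdef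
  have e : (fun i => tr n w i / s - ee j i)
      = s⁻¹ • (tr n w + (-w j) • ee j) + (s⁻¹ * (w j - s)) • ee j := by
    funext i
    simp only [Pi.add_apply, Pi.smul_apply, smul_eq_mul]
    field_simp
    ring
  have f1 := fin_add (tr_fin n w) (fin_smul (-w j) (ee_fin j))
  have h4 := H.tri (s⁻¹ • (tr n w + (-w j) • ee j)) ((s⁻¹ * (w j - s)) • ee j)
    (fin_smul _ f1) (fin_smul _ (ee_fin _))
  rw [← e, H.smul _ _ f1, H.smul _ _ (ee_fin _), abs_mul, abs_of_pos (inv_pos.2 hs),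
    abs_of_nonpos (by linarith : w j - s ≤ 0)] at h4
  refine h4.trans ?_
  have h5 : s⁻¹ * -(w j - s) * nn (ee j) ≤ s⁻¹ * (n * h) := by
    refine (mul_le_of_le_one_right (mul_nonneg (inv_pos.2 hs).le (by linarith)) (H.ee_le j)).trans ?_
    exact mul_le_mul_of_nonneg_left (by linarith) (inv_pos.2 hs).le
  have h6 := mul_le_mul_of_nonneg_left h1 (inv_pos.2 hs).le
  rw [div_eq_inv_mul]
  linarith

/-- off D, `X_j > x` gives A -/
lemma NH.low (H : NH nn) {n j : ℕ} {w : ℕ → ℝ} {η ε x : ℝ} (hw : ∀ i, 0 ≤ w i) (hη : 0 < η)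
    (hj : 1 ≤ j) (hjn : j ≤ n) (hnη : 2 * n * η ≤ ε) (hη1 : η ≤ 1) (hx : 0 < x)
    (hD : w ∉ Dset n (η * x)) (hwj : x < w j) : w ∈ Aset nn j ε n x := by
  have hi : ∀ i, 1 ≤ i → i ≤ n → i ≠ j → w i ≤ η * x := by
    intro i h1 h2 h3
    by_contra hc
    refine hD ⟨i, by simp [h1, h2], j, by simp [hj, hjn], h3, not_le.1 hc, ?_⟩
    nlinarith
  have h3 := H.le_nn (w := w) hj hjn
  have hs : 0 < nn (tr n w) := by linarith
  have hη0 : 0 ≤ η * x := by positivity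
  refine ⟨(H.close hw hη0 hj hjn hi hs).trans_lt ?_, by linarith⟩
  rw [div_lt_iff₀ hs]
  have hn : (0:ℝ) < n := by exact_mod_cast (by omega : 0 < n)
  have : 0 < 2 * n * η := by positivity
  calc 2 * n * (η * x) = (2 * n * η) * x := by ring
    _ < (2 * n * η) * nn (tr n w) := mul_lt_mul_of_pos_left (by linarith) this
    _ ≤ _ := mul_le_mul_of_nonneg_right hnη hs.le

lemma NH.up (H : NH nn) {n j : ℕ} {w : ℕ → ℝ} {η ε x : ℝ} (hw : ∀ i, 0 ≤ w i) (hη : 0 < η)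
    (hj : 1 ≤ j) (hjn : j ≤ n) (hε : ε < 1 / 2) (hη1 : η ≤ 1 / 2) (hx : 0 < x)
    (hA : w ∈ Aset nn j ε n x) : w ∈ Dset n (η * x) ∨ (1 - n * η) * x < w j := by
  by_contra! hc
  obtain ⟨hD, hc⟩ := hc
  obtain ⟨hA1, hA2⟩ := hA
  have hs : 0 < nn (tr n w) := by linarith
  have hwj : η * x < w j := by
    have hf : (Function.support fun i => tr n w i / nn (tr n w) - ee j i).Finite := by
      refine fin_supp (max n j) fun i hi => ?_
      have h1 : tr n w i = 0 := by simp [tr]; omega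
      have h2 : ee j i = 0 := by simp [ee]; omega
      simp [h1, h2]
    have h1 := (H.lower _ hf (j-1)).trans_lt hA1
    have e : tr n w (j-1) = w j := by
      simp [tr, Nat.sub_add_cancel hj, hjn]
    have e2 : ee j (j-1) = 1 := by simp [ee, Nat.sub_add_cancel hj]
    rw [e, e2] at h1
    have h2 := (abs_lt.1 h1).1
    have h3 : 1/2 < w j / nn (tr n w) := by linarith
    rw [lt_div_iff₀ hs] at h3
    nlinarith
  have hi : ∀ i, 1 ≤ i → i ≤ n → i ≠ j → w i ≤ η * x := by
    intro i h1 h2 h3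
    by_contra hc
    exact hD ⟨i, by simp [h1, h2], j, by simp [hj, hjn], h3, not_le.1 hc, hwj⟩
  have := H.nn_le hw (by positivity) hj hjn hi
  linarith

lemma NH.A_lt (H : NH nn) {n j : ℕ} {ε x : ℝ} (hj : 1 ≤ j) (hjn : n < j) (hε : ε < 1 / 2) :
    Aset nn j ε n x = ∅ := by
  ext w
  simp only [Set.mem_empty_iff_false, iff_false]
  rintro ⟨hA1, -⟩
  have hf : (Function.support fun i => tr n w i / nn (tr n w) - ee j i).Finite := by
    refine fin_supp (max n j) fun i hi => ?_
    have h1 : tr n w i = 0 := by simp [tr]; omega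
    have h2 : ee j i = 0 := by simp [ee]; omega
    simp [h1, h2]
  have h1 := (H.lower _ hf (j-1)).trans_lt hA1
  have e : tr n w (j-1) = 0 := by simp [tr]; omega
  have e2 : ee j (j-1) = 1 := by simp [ee, Nat.sub_add_cancel hj]
  rw [e, e2] at h1
  norm_num at h1
  linarith

lemma NH.nn_le_sum (H : NH nn) {n : ℕ} {w : ℕ → ℝ} {h : ℝ} (hw : ∀ i, 0 ≤ w i)
    (hi : ∀ i, 1 ≤ i → i ≤ n → w i ≤ h) : nn (tr n w) ≤ n * h := by
  refine (H.sum_le n fun i hi => by simp [tr]; omega).trans ?_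
  have : ∑ i ∈ Finset.range n, |tr n w i| ≤ ∑ i ∈ Finset.range n, h := by
    refine Finset.sum_le_sum fun i hin => ?_
    have hin' := Finset.mem_range.1 hin
    have h1 : tr n w i = w (i+1) := by simp [tr]; omega
    rw [h1, abs_of_nonneg (hw _)]
    exact hi _ (by omega) (by omega)
  simpa using this

lemma NH.B_sub (H : NH nn) {n : ℕ} {w : ℕ → ℝ} {x : ℝ} (hw : ∀ i, 0 ≤ w i) (hx : 0 < x)
    (hB : w ∈ Bset nn n x) : ∃ i ∈ Finset.Icc 1 n, x / n < w i := by
  by_contra! hc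
  have h1 := H.nn_le_sum (n := n) (h := x / n) hw fun i h1 h2 => hc i (by simp [h1, h2])
  have h2 : (n : ℝ) * (x / n) ≤ x := by
    rcases Nat.eq_zero_or_pos n with h | h
    · simp [h, hx.le]
    · have : (0:ℝ) < n := by exact_mod_cast h
      field_simp; rfl
  have : x < nn (tr n w) := hB
  linarith

lemma NH.B_cover (H : NH nn) {n : ℕ} {w : ℕ → ℝ} {η ε x : ℝ} (hw : ∀ i, 0 ≤ w i) (hη : 0 < η)
    (hnη : 2 * n * η ≤ ε) (hε : ε < 1 / 2) (hx : 0 < x)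
    (hB : w ∈ Bset nn n x) : w ∈ Dset n (η * x) ∨ ∃ j ∈ Finset.Icc 1 n, w ∈ Aset nn j ε n x := by
  by_contra! hc
  obtain ⟨hD, hc⟩ := hc
  have hB' : x < nn (tr n w) := hB
  have hs : 0 < nn (tr n w) := by linarith
  have hη0 : 0 ≤ η * x := by positivity
  have hn0 : (0:ℝ) ≤ n := by positivity
  have hm : ∃ m, 1 ≤ m ∧ m ≤ n ∧ η * x < w m := by
    by_contra! hm
    have := H.nn_le_sum hw hm
    nlinarith
  obtain ⟨m, hm1, hm2, hm⟩ := hm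
  have hi : ∀ i, 1 ≤ i → i ≤ n → i ≠ m → w i ≤ η * x := by
    intro i h1 h2 h3
    by_contra hc
    exact hD ⟨i, by simp [h1, h2], m, by simp [hm1, hm2], h3, not_le.1 hc, hm⟩
  refine hc m (by simp [hm1, hm2]) ⟨(H.close hw hη0 hm1 hm2 hi hs).trans_lt ?_, by linarith⟩
  rw [div_lt_iff₀ hs]
  have hn : (0:ℝ) < n := by exact_mod_cast (by omega : 0 < n)
  have : 0 < 2 * n * η := by positivity
  calc 2 * n * (η * x) = (2 * n * η) * x := by ring
    _ < (2 * n * η) * nn (tr n w) := mul_lt_mul_of_pos_left (by linarith) this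
    _ ≤ _ := mul_le_mul_of_nonneg_right hnη hs.le

lemma NH.A_disj (H : NH nn) {n : ℕ} {ε x : ℝ} (hε : ε < 1 / 2) {j k : ℕ} (hj : 1 ≤ j)
    (hjk : j ≠ k) : Disjoint (Aset nn j ε n x) (Aset nn k ε n x) := by
  rw [Set.disjoint_left]
  rintro w ⟨hA, -⟩ ⟨hB, -⟩
  have hf : ∀ j, (Function.support fun i => tr n w i / nn (tr n w) - ee j i).Finite := by
    intro j
    refine fin_supp (max n j) fun i hi => ?_
    have h1 : tr n w i = 0 := by simp [tr]; omega
    have h2 : ee j i = 0 := by simp [ee]; omega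
    simp [h1, h2]
  have h1 := (H.lower _ (hf j) (j-1)).trans_lt hA
  have h2 := (H.lower _ (hf k) (j-1)).trans_lt hB
  have e2 : ee j (j-1) = 1 := by simp [ee, Nat.sub_add_cancel hj]
  have e3 : ee k (j-1) = 0 := by simp [ee, Nat.sub_add_cancel hj, hjk]
  rw [e2] at h1
  rw [e3] at h2
  rw [abs_lt] at h1 h2
  linarith

lemma potter (F : ℝ → ℝ) (anti : Antitone F) (pos : ∀ x, 0 < x → 0 < F x) (le1 : ∀ x, F x ≤ 1)
    {α β : ℝ} (hβ : α < β) (hβ0 : 0 < β)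
    (rv : Tendsto (fun x => F ((1/2) * x) / F x) atTop (nhds ((1/2 : ℝ) ^ (-α)))) :
    ∃ C : ℝ, 0 < C ∧ ∀ n : ℕ, 1 ≤ n → ∀ x : ℝ, 0 < x → F (x / n) ≤ C * (n : ℝ) ^ β * F x := by
  have h2 : (1/2 : ℝ) ^ (-α) < 2 ^ β := by
    rw [one_div, Real.inv_rpow (by norm_num), ← Real.rpow_neg (by norm_num), neg_neg]
    exact Real.rpow_lt_rpow_of_exponent_lt (by norm_num) hβ
  obtain ⟨x0, hx0⟩ := eventually_atTop.1 ((rv.eventually_lt_const h2).and (eventually_gt_atTop 0))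
  have hx0p : 0 < x0 := (hx0 x0 le_rfl).2
  have hstep : ∀ x, x0 ≤ x → F (x / 2) ≤ 2 ^ β * F x := by
    intro x hx
    have h := (hx0 x hx).1
    rw [div_lt_iff₀ (pos x (hx0 x hx).2)] at h
    have e : x / 2 = (1/2) * x := by ring
    rw [e]; exact h.le
  have hF0 := pos x0 hx0p
  have main : ∀ k : ℕ, ∀ x, 0 < x → F (x / 2 ^ k) ≤ (F x0)⁻¹ * ((2:ℝ) ^ β) ^ k * F x := by
    have hb : (1:ℝ) ≤ 2 ^ β := Real.one_le_rpow (by norm_num) hβ0.le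
    have small : ∀ k : ℕ, ∀ x, 0 < x → x < x0 →
        F (x / 2 ^ k) ≤ (F x0)⁻¹ * ((2:ℝ) ^ β) ^ k * F x := by
      intro k x hx hlt
      have h1 : 1 ≤ (F x0)⁻¹ * F x := by
        rw [← div_eq_inv_mul, le_div_iff₀ hF0, one_mul]; exact anti hlt.le
      have h3 : 1 ≤ ((2:ℝ) ^ β) ^ k := one_le_pow₀ hb
      calc F (x / 2 ^ k) ≤ 1 := le1 _
        _ ≤ ((2:ℝ) ^ β) ^ k * ((F x0)⁻¹ * F x) := one_le_mul_of_one_le_of_one_le h3 h1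
        _ = _ := by ring
    intro k
    induction k with
    | zero =>
      intro x hx
      have h1 : 1 ≤ (F x0)⁻¹ := (one_le_inv₀ hF0).2 (le1 _)
      simp only [pow_zero, div_one, mul_one]
      exact le_mul_of_one_le_left (pos x hx).le h1
    | succ k ih =>
      intro x hx
      rcases lt_or_ge x x0 with hlt | hge
      · exact small _ x hx hlt
      · have e : x / 2 ^ (k+1) = (x / 2) / 2 ^ k := by rw [pow_succ]; field_simp
        rw [e]
        refine (ih (x/2) (by positivity)).trans ?_
        have h0 : 0 ≤ (F x0)⁻¹ * ((2:ℝ) ^ β) ^ k := by positivity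
        refine (mul_le_mul_of_nonneg_left (hstep x hge) h0).trans_eq ?_
        ring
  refine ⟨(F x0)⁻¹ * 2 ^ β, by positivity, fun n hn x hx => ?_⟩
  have hn0 : (0:ℝ) < n := by exact_mod_cast hn
  have hk1 : n ≤ 2 ^ (Nat.clog 2 n) := Nat.le_pow_clog (by norm_num) n
  have hk2 : 2 ^ (Nat.clog 2 n) ≤ 2 * n := by
    rcases Nat.lt_or_ge 1 n with h | h
    · have := Nat.pow_pred_clog_lt_self (b := 2) (by norm_num) h
      have hc : 0 < Nat.clog 2 n := Nat.clog_pos (by norm_num) h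
      obtain ⟨m, hm⟩ := Nat.exists_eq_succ_of_ne_zero hc.ne'
      rw [hm] at this ⊢
      simp only [Nat.pred_succ, Nat.succ_eq_add_one, pow_succ] at this ⊢
      omega
    · have : n = 1 := le_antisymm h hn
      subst this; simp
  set k := Nat.clog 2 n
  have hk1' : (n:ℝ) ≤ 2 ^ k := by exact_mod_cast hk1
  have hk2' : (2:ℝ) ^ k ≤ 2 * n := by exact_mod_cast hk2
  refine (anti (div_le_div_of_nonneg_left hx.le hn0 hk1')).trans ((main k x hx).trans ?_)
  have e : ((2:ℝ) ^ β) ^ k ≤ 2 ^ β * (n:ℝ) ^ β := by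
    rw [← Real.mul_rpow (by norm_num) hn0.le, ← Real.rpow_natCast, ← Real.rpow_mul (by norm_num),
      mul_comm, Real.rpow_mul (by norm_num), Real.rpow_natCast]
    exact Real.rpow_le_rpow (by positivity) hk2' hβ0.le
  refine mul_le_mul_of_nonneg_right ?_ (pos x hx).le
  rw [mul_assoc]
  exact mul_le_mul_of_nonneg_left e (by positivity)

lemma disint {Ω : Type*} [MeasurableSpace Ω] (P : Measure Ω) [IsProbabilityMeasure P]
    (Y : Ω → ℕ → ℝ) (hY : Measurable Y) (N : Ω → ℕ) (hN : Measurable N)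
    (hI : IndepFun N Y P) (E : ℕ → Set (ℕ → ℝ)) (hE : ∀ n, MeasurableSet (E n)) :
    P.real {ω | Y ω ∈ E (N ω)} = ∑' n, P.real {ω | N ω = n} * P.real {ω | Y ω ∈ E n} := by
  have e : {ω | Y ω ∈ E (N ω)} = ⋃ n, (N ⁻¹' {n} ∩ Y ⁻¹' (E n)) := by
    ext ω; simp
  have hm : ∀ n, MeasurableSet (N ⁻¹' {n} ∩ Y ⁻¹' (E n)) := fun n =>
    (hN (measurableSet_singleton n)).inter (hY (hE n))
  have hd : Pairwise (Function.onFun Disjoint fun n => (N ⁻¹' {n} ∩ Y ⁻¹' (E n))) := by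
    intro a b hab
    simp only [Function.onFun, Set.disjoint_left]
    rintro ω ⟨h1, -⟩ ⟨h2, -⟩
    simp at h1 h2
    exact hab (h1.symm.trans h2)
  rw [Measure.real, e, measure_iUnion hd hm, ENNReal.tsum_toReal_eq (fun n => measure_ne_top _ _)]
  refine tsum_congr fun n => ?_
  rw [hI.measure_inter_preimage_eq_mul _ _ (measurableSet_singleton n) (hE n), ENNReal.toReal_mul]
  rfl

lemma summ {Ω : Type*} [MeasurableSpace Ω] (P : Measure Ω) [IsProbabilityMeasure P]
    (N : Ω → ℕ) (hN : Measurable N) {γ : ℝ}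
    (h : ∫⁻ ω, ENNReal.ofReal ((N ω : ℝ) ^ γ) ∂P < ⊤) :
    Summable fun n : ℕ => P.real {ω | N ω = n} * (n : ℝ) ^ γ := by
  have h1 : ∫⁻ ω, ENNReal.ofReal ((N ω : ℝ) ^ γ) ∂P
      = ∑' n : ℕ, ENNReal.ofReal ((n : ℝ) ^ γ) * P {ω | N ω = n} := by
    rw [← lintegral_map (f := fun n : ℕ => ENNReal.ofReal ((n : ℝ) ^ γ)) (measurable_from_nat) hN,
      lintegral_countable']
    refine tsum_congr fun n => ?_
    rw [Measure.map_apply hN (measurableSet_singleton n)]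
    rfl
  rw [h1] at h
  refine (ENNReal.summable_toReal h.ne).congr fun n => ?_
  rw [ENNReal.toReal_mul, ENNReal.toReal_ofReal (by positivity), mul_comm]
  rfl

lemma mean {Ω : Type*} [MeasurableSpace Ω] (P : Measure Ω) [IsProbabilityMeasure P]
    (N : Ω → ℕ) (hN : Measurable N) (hNi : Integrable (fun ω => (N ω : ℝ)) P) :
    ∫ ω, (N ω : ℝ) ∂P = ∑' n : ℕ, P.real {ω | N ω = n} * (n : ℝ) := by
  have hm : AEStronglyMeasurable (fun n : ℕ => (n : ℝ)) (P.map N) :=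
    (measurable_from_nat).aestronglyMeasurable
  rw [← integral_map (f := fun n : ℕ => (n : ℝ)) hN.aemeasurable hm,
    integral_countable' ((integrable_map_measure hm hN.aemeasurable).2 hNi)]
  refine tsum_congr fun n => ?_
  rw [map_measureReal_apply hN (measurableSet_singleton n)]
  rfl

lemma Dlim {Ω : Type*} [MeasurableSpace Ω] (P : Measure Ω) [IsProbabilityMeasure P]
    (X : ℕ → Ω → ℝ)
    (α : ℝ)
    (hpos : ∀ x : ℝ, 0 < x → 0 < P.real {ω | x < X 1 ω})
    (hRV : ∀ t : ℝ, 0 < t →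
      Tendsto (fun x => P.real {ω | t * x < X 1 ω} / P.real {ω | x < X 1 ω})
        atTop (nhds (t ^ (-α))))
    (hUAI : ∀ ε : ℝ, 0 < ε → ∃ x₀ : ℝ, ∀ x ≥ x₀, ∀ i j : ℕ, 1 ≤ i → 1 ≤ j → i ≠ j →
      P.real {ω | x < X i ω ∧ x < X j ω} ≤ ε * P.real {ω | x < X 1 ω})
    (n : ℕ) (η : ℝ) (hη : 0 < η) :
    Tendsto (fun x => P.real {ω | (fun i => X i ω) ∈ Dset n (η * x)} / P.real {ω | x < X 1 ω})
      atTop (nhds 0) := by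
  classical
  have hmul : Tendsto (fun x : ℝ => η * x) atTop atTop := tendsto_id.const_mul_atTop hη
  have hpair : ∀ i k : ℕ, 1 ≤ i → 1 ≤ k → i ≠ k →
      Tendsto (fun x => P.real {ω | η * x < X i ω ∧ η * x < X k ω} / P.real {ω | x < X 1 ω})
        atTop (nhds 0) := by
    intro i k hi hk hik
    have h1 : Tendsto (fun x => P.real {ω | x < X i ω ∧ x < X k ω} / P.real {ω | x < X 1 ω})
        atTop (nhds 0) := by
      rw [Metric.tendsto_nhds]
      intro δ hδ
      obtain ⟨x0, hx0⟩ := hUAI (δ/2) (by positivity)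
      filter_upwards [eventually_ge_atTop x0, eventually_gt_atTop 0] with x hx hxp
      rw [Real.dist_eq, sub_zero, abs_of_nonneg (by positivity), div_lt_iff₀ (hpos x hxp)]
      have := hx0 x hx i k hi hk hik
      have := hpos x hxp
      nlinarith
    have h2 := (h1.comp hmul).mul (hRV η hη)
    rw [zero_mul] at h2
    refine h2.congr' ?_
    filter_upwards [eventually_gt_atTop 0] with x hx
    have := (hpos (η * x) (by positivity)).ne'
    simp only [Function.comp]
    field_simp
  set S := ((Finset.Icc 1 n ×ˢ Finset.Icc 1 n).filter fun p => p.1 ≠ p.2) with hS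
  have hsum : Tendsto (fun x => ∑ p ∈ S,
      P.real {ω | η * x < X p.1 ω ∧ η * x < X p.2 ω} / P.real {ω | x < X 1 ω}) atTop (nhds 0) := by
    have := tendsto_finsetSum (f := fun (p : ℕ × ℕ) x =>
      P.real {ω | η * x < X p.1 ω ∧ η * x < X p.2 ω} / P.real {ω | x < X 1 ω}) (a := fun _ => 0)
      (x := atTop) S (fun p hp => by
        simp only [hS, Finset.mem_filter, Finset.mem_product, Finset.mem_Icc] at hp
        exact hpair _ _ hp.1.1.1 hp.1.2.1 hp.2)
    simpa using this
  refine squeeze_zero (fun x => by positivity) (fun x => ?_) hsum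
  rw [← Finset.sum_div]
  refine div_le_div_of_nonneg_right ?_ measureReal_nonneg
  refine le_trans (measureReal_mono ?_ (measure_ne_top _ _)) (measureReal_biUnion_finset_le S fun p =>
    {ω | η * x < X p.1 ω ∧ η * x < X p.2 ω})
  rintro ω ⟨i, hi, k, hk, hik, h1, h2⟩
  simp only [Set.mem_iUnion]
  exact ⟨(i, k), by simp only [hS, Finset.mem_filter, Finset.mem_product]; exact ⟨⟨hi, hk⟩, hik⟩, h1, h2⟩

section
variable {Ω : Type*} [MeasurableSpace Ω] (P : Measure Ω) [IsProbabilityMeasure P]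
    (X : ℕ → Ω → ℝ) (nn : (ℕ → ℝ) → ℝ)

lemma Alim (H : NH nn) (hXnonneg : ∀ i ω, 0 ≤ X i ω)
    (α : ℝ)
    (hpos : ∀ x : ℝ, 0 < x → 0 < P.real {ω | x < X 1 ω})
    (hid : ∀ i, 1 ≤ i → ∀ x, P.real {ω | x < X i ω} = P.real {ω | x < X 1 ω})
    (hRV : ∀ t : ℝ, 0 < t →
      Tendsto (fun x => P.real {ω | t * x < X 1 ω} / P.real {ω | x < X 1 ω})
        atTop (nhds (t ^ (-α))))
    (hD : ∀ (n : ℕ) (η : ℝ), 0 < η →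
      Tendsto (fun x => P.real {ω | (fun i => X i ω) ∈ Dset n (η * x)} / P.real {ω | x < X 1 ω})
      atTop (nhds 0))
    (n j : ℕ) (hj : 1 ≤ j) (hjn : j ≤ n) (ε : ℝ) (hε : 0 < ε) (hε2 : ε < 1 / 2) :
    Tendsto (fun x => P.real {ω | (fun i => X i ω) ∈ Aset nn j ε n x} / P.real {ω | x < X 1 ω})
      atTop (nhds 1) := by
  have hn : (0:ℝ) < n := by exact_mod_cast (by omega : 0 < n)
  rw [tendsto_order]
  constructor
  · intro a ha
    set η := min 1 (ε / (2 * n)) with hηd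
    have hη : 0 < η := by positivity
    have h2 : 2 * n * η ≤ ε := by
      have := min_le_right 1 (ε / (2 * n))
      rw [← hηd, le_div_iff₀ (by positivity)] at this
      linarith
    have hl := (hD n η hη).const_sub 1
    rw [sub_zero] at hl
    filter_upwards [hl.eventually_const_lt ha, eventually_gt_atTop 0] with x hx hxp
    refine hx.trans_le ?_
    have hp := hpos x hxp
    rw [sub_le_iff_le_add, ← add_div, one_le_div hp, ← hid j hj]
    refine le_trans (measureReal_mono ?_) (measureReal_union_le _ _)
    intro ω hω
    by_cases hDm : (fun i => X i ω) ∈ Dset n (η * x)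
    · exact Or.inr hDm
    · exact Or.inl (H.low (fun i => hXnonneg i ω) hη hj hjn h2 (min_le_left _ _) hxp hDm hω)
  · intro a ha
    have hc : Tendsto (fun η : ℝ => (1 - n * η) ^ (-α)) (nhds 0) (nhds 1) := by
      have : ContinuousAt (fun η : ℝ => (1 - n * η) ^ (-α)) 0 :=
        ContinuousAt.rpow_const (by fun_prop) (Or.inl (by simp))
      simpa [ContinuousAt] using this
    have hc2 : Tendsto (fun η : ℝ => 1 - n * η) (nhds 0) (nhds 1) := by
      have : ContinuousAt (fun η : ℝ => 1 - n * η) 0 := by fun_prop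
      simpa [ContinuousAt] using this
    have hev := ((hc.eventually_lt_const ha).and (hc2.eventually_const_lt one_pos)).and
      (eventually_lt_nhds (show (0:ℝ) < 1/2 by norm_num))
    obtain ⟨η, ⟨⟨h1, h2⟩, h3⟩, hη⟩ := ((hev.filter_mono nhdsWithin_le_nhds).and
      (self_mem_nhdsWithin (s := Set.Ioi (0:ℝ)))).exists
    have hl := (hRV _ h2).add (hD n η hη)
    rw [add_zero] at hl
    filter_upwards [hl.eventually_lt_const h1, eventually_gt_atTop 0] with x hx hxp
    refine lt_of_le_of_lt ?_ hx
    rw [← add_div]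
    refine div_le_div_of_nonneg_right ?_ measureReal_nonneg
    rw [← hid j hj]
    refine le_trans (measureReal_mono ?_) (measureReal_union_le _ _)
    intro ω hω
    exact (H.up (fun i => hXnonneg i ω) hη hj hjn hε2 h3.le hxp hω).symm

lemma Blim (H : NH nn) (hXnonneg : ∀ i ω, 0 ≤ X i ω) (hXm : Measurable fun ω i => X i ω)
    (hD : ∀ (n : ℕ) (η : ℝ), 0 < η →
      Tendsto (fun x => P.real {ω | (fun i => X i ω) ∈ Dset n (η * x)} / P.real {ω | x < X 1 ω})
      atTop (nhds 0))
    (n : ℕ) (ε : ℝ) (hε : 0 < ε) (hε2 : ε < 1 / 2)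
    (hA : ∀ j, 1 ≤ j → j ≤ n →
      Tendsto (fun x => P.real {ω | (fun i => X i ω) ∈ Aset nn j ε n x} / P.real {ω | x < X 1 ω})
      atTop (nhds 1)) :
    Tendsto (fun x => P.real {ω | (fun i => X i ω) ∈ Bset nn n x} / P.real {ω | x < X 1 ω})
      atTop (nhds n) := by
  have hsum : Tendsto (fun x => ∑ j ∈ Finset.Icc 1 n,
      P.real {ω | (fun i => X i ω) ∈ Aset nn j ε n x} / P.real {ω | x < X 1 ω}) atTop (nhds n) := by
    have := tendsto_finsetSum (f := fun j x =>
      P.real {ω | (fun i => X i ω) ∈ Aset nn j ε n x} / P.real {ω | x < X 1 ω}) (a := fun _ => 1)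
      (x := atTop) (Finset.Icc 1 n) (fun p hp => hA p (Finset.mem_Icc.1 hp).1 (Finset.mem_Icc.1 hp).2)
    simpa using this
  set η := ε / (2 * n + 1) with hηd
  have hη : 0 < η := by positivity
  have h2 : 2 * n * η ≤ ε := by
    have : η * (2 * n + 1) = ε := by rw [hηd]; field_simp
    linarith
  have hup := hsum.add (hD n η hη)
  rw [add_zero] at hup
  have hun : ∀ x, P.real (⋃ j ∈ Finset.Icc 1 n, {ω | (fun i => X i ω) ∈ Aset nn j ε n x})
      = ∑ j ∈ Finset.Icc 1 n, P.real {ω | (fun i => X i ω) ∈ Aset nn j ε n x} := by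
    intro x
    refine measureReal_biUnion_finset ?_ fun j _ => hXm (H.measA j ε n x)
    intro j hj k hk hjk
    exact (H.A_disj (n := n) (x := x) hε2 (Finset.mem_Icc.1 hj).1 hjk).preimage
      (fun ω i => X i ω)
  refine tendsto_of_tendsto_of_tendsto_of_le_of_le' hsum hup (Eventually.of_forall fun x => ?_) ?_
  · rw [← Finset.sum_div, ← hun]
    refine div_le_div_of_nonneg_right (measureReal_mono ?_) measureReal_nonneg
    intro ω hω
    simp only [Set.mem_iUnion] at hω
    obtain ⟨j, _, hω⟩ := hω
    exact hω.2
  · filter_upwards [eventually_gt_atTop 0] with x hxp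
    rw [← Finset.sum_div, ← hun, ← add_div]
    refine div_le_div_of_nonneg_right ?_ measureReal_nonneg
    refine le_trans (measureReal_mono ?_) (measureReal_union_le _ _)
    intro ω hω
    rcases H.B_cover (fun i => hXnonneg i ω) hη h2 hε2 hxp hω with h | ⟨j, hj, h⟩
    · exact Or.inr h
    · exact Or.inl (Set.mem_biUnion hj h)

lemma Bbound (H : NH nn) (hXnonneg : ∀ i ω, 0 ≤ X i ω)
    (hid : ∀ i, 1 ≤ i → ∀ x, P.real {ω | x < X i ω} = P.real {ω | x < X 1 ω})
    (n : ℕ) (x : ℝ) (hx : 0 < x) :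
    P.real {ω | (fun i => X i ω) ∈ Bset nn n x} ≤ n * P.real {ω | x / n < X 1 ω} := by
  have h1 : P.real {ω | (fun i => X i ω) ∈ Bset nn n x}
      ≤ P.real (⋃ i ∈ Finset.Icc 1 n, {ω | x / n < X i ω}) := by
    refine measureReal_mono ?_ (measure_ne_top _ _)
    intro ω hω
    obtain ⟨i, hi, h⟩ := H.B_sub (fun i => hXnonneg i ω) hx hω
    exact Set.mem_biUnion hi h
  refine h1.trans ((measureReal_biUnion_finset_le _ _).trans ?_)
  rw [Finset.sum_congr rfl fun i hi => hid i (Finset.mem_Icc.1 hi).1 _]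
  simp
end
end

theorem random_length_spectral_measure
    {Ω : Type*} [MeasurableSpace Ω] (P : Measure Ω) [IsProbabilityMeasure P]
    (X : ℕ → Ω → ℝ) (hXmeas : ∀ i, Measurable (X i))
    (hXnonneg : ∀ i ω, 0 ≤ X i ω)
    (hXid : ∀ i, 1 ≤ i → IdentDistrib (X i) (X 1) P P)
    (α : ℝ) (hα : 0 < α)
    (hRVpos : ∀ x : ℝ, 0 < x → 0 < P {ω | x < X 1 ω})
    (hRV : ∀ t : ℝ, 0 < t →
      Tendsto (fun x => (P {ω | t * x < X 1 ω}).toReal / (P {ω | x < X 1 ω}).toReal)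
        atTop (nhds (t ^ (-α))))
    (hUAI : ∀ ε : ℝ, 0 < ε → ∃ x₀ : ℝ, ∀ x ≥ x₀, ∀ i j : ℕ, 1 ≤ i → 1 ≤ j → i ≠ j →
      (P {ω | x < X i ω ∧ x < X j ω}).toReal ≤ ε * (P {ω | x < X 1 ω}).toReal)
    (N : Ω → ℕ) (hNmeas : Measurable N) (hNpos : ∀ ω, 1 ≤ N ω)
    (hNindep : IndepFun N (fun ω => fun i : ℕ => X i ω) P)
    (hNmom : ∃ ε : ℝ, 0 < ε ∧
      ∫⁻ ω, ENNReal.ofReal ((N ω : ℝ) ^ ((2 : ℝ) + α + ε)) ∂P < ⊤)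
    (nn : (ℕ → ℝ) → ℝ)
    (hnn_tri : ∀ u v : ℕ → ℝ, (Function.support u).Finite → (Function.support v).Finite →
      nn (u + v) ≤ nn u + nn v)
    (hnn_smul : ∀ (c : ℝ) (u : ℕ → ℝ), (Function.support u).Finite →
      nn (c • u) = |c| * nn u)
    (hnn_zero : ∀ u : ℕ → ℝ, (Function.support u).Finite → nn u = 0 → u = 0)
    (hnn_lower : ∀ u : ℕ → ℝ, (Function.support u).Finite → ∀ i, |u i| ≤ nn u)
    (hnn_upper : ∀ u : ℕ → ℝ, (Function.support u).Finite → nn u ≤ ∑' i, |u i|) :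
    ∀ j : ℕ, 1 ≤ j → ∀ ε' : ℝ, 0 < ε' → ε' < 1 / 2 →
      Tendsto (fun x =>
          (P {ω |
              nn (fun i =>
                  (if i + 1 ≤ N ω then X (i + 1) ω else 0)
                    / nn (fun i' => if i' + 1 ≤ N ω then X (i' + 1) ω else 0)
                  - (if i + 1 = j then 1 else 0)) < ε'
              ∧ x < nn (fun i => if i + 1 ≤ N ω then X (i + 1) ω else 0)}).toReal
            / (P {ω | x < nn (fun i => if i + 1 ≤ N ω then X (i + 1) ω else 0)}).toReal)
        atTop (nhds ((P {ω | j ≤ N ω}).toReal / ∫ ω, (N ω : ℝ) ∂P)) := by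
  intro j hj ε hε hε2
  have H : NH nn := ⟨hnn_tri, hnn_smul, hnn_lower, hnn_upper⟩
  have hXm : Measurable fun ω i => X i ω := measurable_pi_lambda _ hXmeas
  have hpos : ∀ x : ℝ, 0 < x → 0 < P.real {ω | x < X 1 ω} := fun x hx =>
    ENNReal.toReal_pos (hRVpos x hx).ne' (measure_ne_top _ _)
  have hid : ∀ i, 1 ≤ i → ∀ x, P.real {ω | x < X i ω} = P.real {ω | x < X 1 ω} := by
    intro i hi x
    exact congrArg ENNReal.toReal ((hXid i hi).measure_mem_eq (s := Set.Ioi x) measurableSet_Ioi)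
  have hD := Dlim P X α hpos hRV hUAI
  have hA := Alim P X nn H hXnonneg α hpos hid hRV hD
  have hB := fun n => Blim P X nn H hXnonneg hXm hD n ε hε hε2
    (fun j h1 h2 => hA n j h1 h2 ε hε hε2)
  obtain ⟨δ, hδ, hmom⟩ := hNmom
  obtain ⟨C, hC, hpot⟩ := potter (fun x => P.real {ω | x < X 1 ω})
    (fun x y hxy => measureReal_mono fun ω (h : y < X 1 ω) => lt_of_le_of_lt hxy h)
    hpos (fun x => measureReal_le_one) (α := α) (β := α + δ) (by linarith) (by linarith)
    (hRV (1/2) (by norm_num))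
  have hsm := summ P N hNmeas hmom
  have hpow : ∀ n : ℕ, (n:ℝ) * (n:ℝ) ^ (α + δ) ≤ (n:ℝ) ^ (2 + α + δ) := by
    intro n
    rcases Nat.eq_zero_or_pos n with h | h
    · subst h; simp; positivity
    · have h1 : (1:ℝ) ≤ n := by exact_mod_cast h
      have : (n:ℝ) * (n:ℝ) ^ (α + δ) = (n:ℝ) ^ (1 + (α + δ)) := by
        rw [Real.rpow_add (by linarith) 1, Real.rpow_one]
      rw [this]
      exact Real.rpow_le_rpow_of_exponent_le h1 (by linarith)
  have hBb : ∀ (n : ℕ) (x : ℝ), 0 < x →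
      P.real {ω | (fun i => X i ω) ∈ Bset nn n x} / P.real {ω | x < X 1 ω}
        ≤ C * (n:ℝ) ^ (2 + α + δ) := by
    intro n x hx
    rw [div_le_iff₀ (hpos x hx)]
    refine (Bbound P X nn H hXnonneg hid n x hx).trans ?_
    rcases Nat.eq_zero_or_pos n with h | h
    · subst h; simp; positivity
    · calc (n:ℝ) * P.real {ω | x / n < X 1 ω}
          ≤ n * (C * (n : ℝ) ^ (α + δ) * P.real {ω | x < X 1 ω}) :=
            mul_le_mul_of_nonneg_left (hpot n h x hx) (by positivity)
        _ = C * (n * (n : ℝ) ^ (α + δ)) * P.real {ω | x < X 1 ω} := by ring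
        _ ≤ _ := by gcongr; exact hpow n
  -- generic dominated convergence
  have dom : ∀ (E : ℕ → ℝ → Set (ℕ → ℝ)) (L : ℕ → ℝ), (∀ n x, MeasurableSet (E n x)) →
      (∀ n x, E n x ⊆ Bset nn n x) →
      (∀ n, Tendsto (fun x => P.real {ω | (fun i => X i ω) ∈ E n x} / P.real {ω | x < X 1 ω})
        atTop (nhds (L n))) →
      Tendsto (fun x => P.real {ω | (fun i => X i ω) ∈ E (N ω) x} / P.real {ω | x < X 1 ω})
        atTop (nhds (∑' n, P.real {ω | N ω = n} * L n)) := by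
    intro E L hE hsub hL
    have e : ∀ x, P.real {ω | (fun i => X i ω) ∈ E (N ω) x} / P.real {ω | x < X 1 ω}
        = ∑' n, P.real {ω | N ω = n} *
          (P.real {ω | (fun i => X i ω) ∈ E n x} / P.real {ω | x < X 1 ω}) := by
      intro x
      rw [disint P _ hXm N hNmeas hNindep (fun n => E n x) (fun n => hE n x), ← tsum_div_const]
      exact tsum_congr fun n => by rw [mul_div_assoc]
    simp_rw [e]
    refine tendsto_tsum_of_dominated_convergence (hsm.mul_left C)
      (fun n => (hL n).const_mul _) ?_
    filter_upwards [eventually_gt_atTop 0] with x hx n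
    rw [Real.norm_of_nonneg (by positivity)]
    have h1 : P.real {ω | (fun i => X i ω) ∈ E n x} / P.real {ω | x < X 1 ω}
        ≤ C * (n:ℝ) ^ (2 + α + δ) := by
      refine le_trans ?_ (hBb n x hx)
      refine div_le_div_of_nonneg_right (measureReal_mono ?_) measureReal_nonneg
      exact fun ω hω => hsub n x hω
    calc _ ≤ P.real {ω | N ω = n} * (C * (n:ℝ) ^ (2 + α + δ)) :=
          mul_le_mul_of_nonneg_left h1 measureReal_nonneg
      _ = _ := by ring
  have dB := dom (fun n x => Bset nn n x) (fun n => n) (fun n x => H.measB n x)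
    (fun n x => subset_rfl) hB
  have dA := dom (fun n x => Aset nn j ε n x) (fun n => if j ≤ n then 1 else 0)
    (fun n x => H.measA j ε n x) (fun n x w hw => hw.2) (by
      intro n
      by_cases h : j ≤ n
      · simp only [h, if_true]; exact hA n j hj h ε hε hε2
      · simp only [h, if_false, H.A_lt hj (not_le.1 h) hε2]
        simp)
  have hNi : Integrable (fun ω => (N ω : ℝ)) P := by
    refine ⟨(measurable_from_nat (f := fun n : ℕ => (n:ℝ)).comp hNmeas).aestronglyMeasurable, ?_⟩
    refine lt_of_le_of_lt (lintegral_mono fun ω => ?_) hmom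
    rw [← ofReal_norm_eq_enorm]
    refine ENNReal.ofReal_le_ofReal ?_
    rw [Real.norm_of_nonneg (by positivity)]
    have h1 : (1:ℝ) ≤ N ω := by exact_mod_cast hNpos ω
    calc (N ω : ℝ) = (N ω : ℝ) ^ (1:ℝ) := (Real.rpow_one _).symm
      _ ≤ _ := Real.rpow_le_rpow_of_exponent_le h1 (by linarith)
  rw [← mean P N hNmeas hNi] at dB
  have hj' : ∑' n, P.real {ω | N ω = n} * (if j ≤ n then (1:ℝ) else 0) = P.real {ω | j ≤ N ω} := by
    have := disint P _ hXm N hNmeas hNindep (fun n => {_w | j ≤ n}) (fun n => MeasurableSet.const _)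
    simp only [Set.mem_setOf_eq] at this
    rw [this]
    refine tsum_congr fun n => ?_
    by_cases h : j ≤ n <;> simp [h]
  rw [hj'] at dA
  have hEN : (1:ℝ) ≤ ∫ ω, (N ω : ℝ) ∂P := by
    have := integral_mono (μ := P) (integrable_const (1:ℝ)) hNi
      (fun ω => (by exact_mod_cast hNpos ω : (1:ℝ) ≤ N ω))
    simpa using this
  refine (dA.div dB (by linarith)).congr' ?_
  filter_upwards [eventually_gt_atTop 0] with x hx
  have := (hpos x hx).ne'
  rw [Pi.div_apply, div_div_div_cancel_right₀ this]
  rfl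
end

section
/- Let (X_i)_{i≥1} be identically distributed nonnegative random variables such that X₁ is regularly varying with index α > 0 and the family is uniformly asymptotically independent. Fix n ≥ 1 and let ‖·‖ be a norm on ℝⁿ satisfying max_{1≤i≤n}|u_i| ≤ ‖u‖ ≤ ∑_{i=1}^n |u_i|. Let A = (a_{i,j})_{1≤i,j≤n} be a random n×n matrix with nonnegative entries, independent of (X₁,…,X_n), such that E[‖A‖^{α+ε}] < ∞ for some ε > 0, where ‖A‖ is the operator norm induced by ‖·‖. Then lim_{x→∞} P(‖A·(X₁,…,X_n)‖ > x) / P(X₁ > x) = E[ ∑_{k=1}^n ‖A_k‖^α ], where A_k is the k-th column of A. -/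
open MeasureTheory ProbabilityTheory Filter

/-- The operator norm of the linear map `u ↦ M.mulVec u` on `ℝⁿ` induced by the norm `nn`,
where the matrix `M` is given as `M : Fin n → Fin n → ℝ`. -/
noncomputable def inducedOpNorm {n : ℕ} (nn : (Fin n → ℝ) → ℝ) (M : Fin n → Fin n → ℝ) : ℝ :=
  ⨆ u : {u : Fin n → ℝ // nn u ≤ 1}, nn (fun i => ∑ j, M i j * (u : Fin n → ℝ) j)

lemma potter_aux (F : ℝ → ℝ) (hanti : Antitone F) (hpos : ∀ x, 0 < x → 0 < F x)
    (hle : ∀ x, F x ≤ 1) (α β : ℝ) (hα : 0 < α) (hβ : α < β)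
    (h : Tendsto (fun x => F ((1/2) * x) / F x) atTop (nhds ((1/2 : ℝ) ^ (-α)))) :
    ∃ C x₀ : ℝ, 0 < C ∧ 0 < x₀ ∧ ∀ x ≥ x₀, ∀ c > 0, F (x / c) ≤ C * (1 + c ^ β) * F x := by
  have h2 : ((1/2 : ℝ) ^ (-α)) < 2 ^ β := by
    rw [one_div, Real.inv_rpow (by norm_num), Real.rpow_neg (by norm_num), inv_inv]
    exact Real.rpow_lt_rpow_of_exponent_lt (by norm_num) hβ
  obtain ⟨x₁, hx₁⟩ := eventually_atTop.1 (h.eventually (gt_mem_nhds h2))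
  set x₀ := max x₁ 1 with hx₀
  have hx0 : 0 < x₀ := lt_of_lt_of_le one_pos (le_max_right _ _)
  have step : ∀ x ≥ x₀, F (x / 2) ≤ 2 ^ β * F x := by
    intro x hx
    have := hx₁ x (le_trans (le_max_left _ _) hx)
    rw [div_lt_iff₀ (hpos x (lt_of_lt_of_le hx0 hx))] at this
    rw [show x / 2 = 1 / 2 * x by ring]; exact this.le
  have hB : (1:ℝ) ≤ 2 ^ β := Real.one_le_rpow (by norm_num) (by linarith)
  have hF0 := hpos x₀ hx0
  set K := (F x₀)⁻¹ with hK
  have hK1 : 1 ≤ K := one_le_inv_iff₀.2 ⟨hF0, hle _⟩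
  have hKF : K * F x₀ = 1 := inv_mul_cancel₀ hF0.ne'
  have key : ∀ m : ℕ, ∀ x ≥ x₀, F (x / 2 ^ m) ≤ K * (2 ^ β) ^ m * F x := by
    intro m
    induction m with
    | zero =>
      intro x hx
      have := hpos x (lt_of_lt_of_le hx0 hx)
      simp; nlinarith
    | succ m ih =>
      intro x hx
      have hm : (1:ℝ) ≤ (2 ^ β) ^ m := one_le_pow₀ hB
      have hs := step x hx
      have e : K * (2 ^ β) ^ (m+1) * F x = K * (2 ^ β) ^ m * (2 ^ β * F x) := by ring
      have hc : F (x / 2 ^ (m+1)) ≤ K * (2 ^ β) ^ m * F (x / 2) := by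
        rcases le_total x₀ (x/2) with h' | h'
        · have := ih (x/2) h'
          rwa [div_div, ← pow_succ'] at this
        · have h3 := hanti h'
          calc F (x / 2 ^ (m+1)) ≤ 1 := hle _
            _ = K * 1 * F x₀ := by rw [mul_one, hKF]
            _ ≤ K * (2 ^ β) ^ m * F (x / 2) := by gcongr
      rw [e]
      exact hc.trans (by gcongr)
  refine ⟨K * 2 ^ β, x₀, by positivity, hx0, fun x hx c hc => ?_⟩
  have hxp := lt_of_lt_of_le hx0 hx
  have hFx := hpos x hxp
  have hcb : 0 < c ^ β := Real.rpow_pos_of_pos hc _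
  rcases le_total c 1 with h1 | h1
  · have : F (x / c) ≤ F x := hanti (by rw [le_div_iff₀ hc]; nlinarith)
    refine this.trans ?_
    have h4 : 1 ≤ K * 2 ^ β * (1 + c ^ β) :=
      one_le_mul_of_one_le_of_one_le (one_le_mul_of_one_le_of_one_le hK1 hB) (by linarith)
    nlinarith
  · obtain ⟨m, hm1, hm2⟩ := exists_nat_pow_near h1 (by norm_num : (1:ℝ) < 2)
    have h5 : F (x / c) ≤ F (x / 2 ^ (m+1)) := hanti (by gcongr)
    have h6 : ((2:ℝ) ^ β) ^ m ≤ c ^ β := by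
      rw [← Real.rpow_natCast, ← Real.rpow_mul (by norm_num), mul_comm β, Real.rpow_mul (by norm_num),
        Real.rpow_natCast]
      exact Real.rpow_le_rpow (by positivity) hm1 (by linarith)
    calc _ ≤ _ := h5
      _ ≤ _ := key (m+1) x hx
      _ = K * 2 ^ β * ((2 ^ β) ^ m) * F x := by ring
      _ ≤ _ := by gcongr; linarith

section nnl
variable {n : ℕ} {nn : (Fin n → ℝ) → ℝ}

lemma nn_zero' (hs : ∀ (c : ℝ) u, nn (c • u) = |c| * nn u) : nn 0 = 0 := by
  simpa using hs 0 0

lemma nn_nonneg' (ht : ∀ u v, nn (u + v) ≤ nn u + nn v)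
    (hs : ∀ (c : ℝ) u, nn (c • u) = |c| * nn u) (u) : 0 ≤ nn u := by
  have h1 := ht u ((-1:ℝ) • u)
  rw [hs] at h1
  have : u + (-1:ℝ) • u = 0 := by simp
  rw [this, nn_zero' hs] at h1
  norm_num at h1; linarith

lemma nn_eq_sum (a : Fin n → Fin n → ℝ) (y : Fin n → ℝ) :
    (fun i => ∑ j, a i j * y j) = ∑ j, y j • (fun i => a i j) := by
  ext i; simp [Finset.sum_apply, mul_comm]

lemma nn_sum_le (ht : ∀ u v, nn (u + v) ≤ nn u + nn v)
    (hs : ∀ (c : ℝ) u, nn (c • u) = |c| * nn u) (a : Fin n → Fin n → ℝ) (y : Fin n → ℝ)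
    (s : Finset (Fin n)) :
    nn (∑ j ∈ s, y j • (fun i => a i j)) ≤ ∑ j ∈ s, |y j| * nn (fun i => a i j) := by
  refine (Finset.le_sum_of_subadditive nn (nn_zero' hs).le ht s _).trans (le_of_eq ?_)
  exact Finset.sum_congr rfl fun j _ => hs _ _

lemma nn_sum_ge (ht : ∀ u v, nn (u + v) ≤ nn u + nn v)
    (hs : ∀ (c : ℝ) u, nn (c • u) = |c| * nn u) (a : Fin n → Fin n → ℝ) (y : Fin n → ℝ)
    (k : Fin n) :
    |y k| * nn (fun i => a i k) ≤ nn (fun i => ∑ j, a i j * y j) +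
      ∑ j ∈ Finset.univ.erase k, |y j| * nn (fun i => a i j) := by
  rw [nn_eq_sum, ← hs]
  have h1 := nn_sum_le ht hs a y (Finset.univ.erase k)
  have h2 := ht (∑ j, y j • (fun i => a i j))
    ((-1:ℝ) • ∑ j ∈ Finset.univ.erase k, y j • (fun i => a i j))
  rw [hs] at h2
  have h3 : (∑ j, y j • (fun i => a i j)) +
    ((-1:ℝ) • ∑ j ∈ Finset.univ.erase k, y j • (fun i => a i j)) = y k • (fun i => a i k) := by
    rw [← Finset.add_sum_erase _ _ (Finset.mem_univ k)]; simp
  rw [h3] at h2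
  rw [abs_neg, abs_one, one_mul] at h2
  linarith

lemma nn_cont (ht : ∀ u v, nn (u + v) ≤ nn u + nn v)
    (hu : ∀ u, nn u ≤ ∑ i, |u i|) : Continuous nn := by
  have key : ∀ u v, nn u - nn v ≤ n * dist u v := by
    intro u v
    have h1 := ht (u - v) v
    have h2 := hu (u - v)
    have h3 : ∑ i, |(u - v) i| ≤ ∑ _i : Fin n, dist u v :=
      Finset.sum_le_sum fun i _ => by
        simpa [Real.dist_eq] using dist_le_pi_dist u v i
    simp at h1 h3 h2
    linarith
  refine (LipschitzWith.of_dist_le_mul (K := n) fun u v => ?_).continuous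
  rw [Real.dist_eq, abs_le]
  have h1 := key u v
  have h2 := key v u
  rw [dist_comm v u] at h2
  constructor <;> simp <;> linarith

lemma col_le_op (ht : ∀ u v, nn (u + v) ≤ nn u + nn v)
    (hs : ∀ (c : ℝ) u, nn (c • u) = |c| * nn u)
    (hl : ∀ u, ∀ i, |u i| ≤ nn u) (hu : ∀ u, nn u ≤ ∑ i, |u i|)
    (M : Fin n → Fin n → ℝ) (k : Fin n) : nn (fun i => M i k) ≤ inducedOpNorm nn M := by
  have hb : BddAbove (Set.range fun u : {u : Fin n → ℝ // nn u ≤ 1} =>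
      nn (fun i => ∑ j, M i j * (u : Fin n → ℝ) j)) := by
    refine ⟨∑ j, nn (fun i => M i j), ?_⟩
    rintro _ ⟨⟨u, h⟩, rfl⟩
    simp only
    rw [nn_eq_sum]
    refine (nn_sum_le ht hs M u _).trans (Finset.sum_le_sum fun j _ => ?_)
    have := nn_nonneg' ht hs (fun i => M i j)
    have := (hl u j).trans h
    nlinarith
  have h1 : nn (Pi.single k 1) ≤ 1 := by
    refine (hu _).trans (le_of_eq ?_)
    rw [Finset.sum_eq_single k] <;> simp +contextual
  have := le_ciSup hb ⟨Pi.single k 1, h1⟩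
  simpa [Pi.single_apply, inducedOpNorm] using this

/-- deterministic upper inclusion -/
lemma det_upper (hn : 1 ≤ n) (z : Fin n → ℝ) (hz : ∀ k, 0 ≤ z k) (x δ : ℝ) (hδ : 0 ≤ δ * x)
    (h : x < ∑ k, z k) (h1 : ∀ k, z k ≤ (1 - δ) * x) :
    ∃ i j, i ≠ j ∧ δ * x / n < z i ∧ δ * x / n < z j := by
  have : Nonempty (Fin n) := ⟨⟨0, hn⟩⟩
  have hn' : (0:ℝ) < n := by exact_mod_cast hn
  obtain ⟨k, hk⟩ := Finite.exists_max z
  rw [← Finset.add_sum_erase _ _ (Finset.mem_univ k)] at h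
  have h2 : δ * x < ∑ j ∈ Finset.univ.erase k, z j := by have := h1 k; linarith
  by_contra! hc
  have h3 : ∀ j ∈ Finset.univ.erase k, z j ≤ δ * x / n := by
    intro j hj
    by_contra! h4
    have := hc j k (Finset.ne_of_mem_erase hj) h4
    exact absurd (hk j) (by linarith)
  have h4 := Finset.sum_le_sum h3
  rw [Finset.sum_const, nsmul_eq_mul] at h4
  rcases Finset.eq_empty_or_nonempty (Finset.univ.erase k) with he | ⟨j, hj⟩
  · rw [he] at h2
    simp at h2
    linarith
  · have h5 : 0 ≤ δ * x / n := (hz j).trans (h3 j hj)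
    have h6 : ((Finset.univ.erase k).card : ℝ) ≤ n := by
      exact_mod_cast (Finset.card_le_univ _).trans (by simp)
    have h7 : n * (δ * x / n) = δ * x := by field_simp
    nlinarith
end nnl

lemma pointwise_tail {Ω : Type*} [MeasurableSpace Ω] (P : Measure Ω) [IsProbabilityMeasure P]
    {n : ℕ} (hn : 1 ≤ n) (nn : (Fin n → ℝ) → ℝ)
    (ht : ∀ u v, nn (u + v) ≤ nn u + nn v)
    (hs : ∀ (c : ℝ) u, nn (c • u) = |c| * nn u)
    (F : ℝ → ℝ) (hFpos : ∀ x, 0 < x → 0 < F x) (α : ℝ) (hα : 0 < α)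
    (hRV : ∀ t : ℝ, 0 < t → Tendsto (fun x => F (t * x) / F x) atTop (nhds (t ^ (-α))))
    (Y : Fin n → Ω → ℝ) (hYm : ∀ k, Measurable (Y k)) (hY0 : ∀ k ω, 0 ≤ Y k ω)
    (hYF : ∀ k x, P.real {ω | x < Y k ω} = F x)
    (hU : ∀ ε : ℝ, 0 < ε → ∃ x₀ : ℝ, ∀ x ≥ x₀, ∀ i j, i ≠ j →
      P.real {ω | x < Y i ω ∧ x < Y j ω} ≤ ε * F x)
    (a : Fin n → Fin n → ℝ) :
    Tendsto (fun x => P.real {ω | x < nn (fun i => ∑ j, a i j * Y j ω)} / F x) atTop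
      (nhds (∑ k, nn (fun i => a i k) ^ α)) := by
  have hn' : (0:ℝ) < n := by exact_mod_cast hn
  have hn1 : (1:ℝ) ≤ n := by exact_mod_cast hn
  set N : Fin n → ℝ := fun k => nn (fun i => a i k) with hN
  have hN0 : ∀ k, 0 ≤ N k := fun k => nn_nonneg' ht hs _
  -- single tails
  have T1 : ∀ s : ℝ, 0 < s → ∀ k, Tendsto (fun x => P.real {ω | s * x < N k * Y k ω} / F x) atTop
      (nhds (s ^ (-α) * N k ^ α)) := by
    intro s hs0 k
    rcases (hN0 k).eq_or_lt with h0 | h0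
    · rw [← h0, Real.zero_rpow hα.ne', mul_zero]
      refine tendsto_const_nhds.congr' ?_
      filter_upwards [eventually_gt_atTop 0] with x hx
      have : ¬ s * x < 0 := not_lt.2 (by positivity)
      simp [this]
    · have h := hRV (s / N k) (by positivity)
      rw [Real.div_rpow hs0.le h0.le, Real.rpow_neg h0.le, div_inv_eq_mul] at h
      refine h.congr fun x => ?_
      rw [← hYF k]
      congr 2
      ext ω
      simp only [Set.mem_ofPred_eq]
      rw [div_mul_eq_mul_div, div_lt_iff₀ h0, mul_comm (Y k ω)]
  have T : ∀ s : ℝ, 0 < s →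
      Tendsto (fun x => (∑ k, P.real {ω | s * x < N k * Y k ω}) / F x) atTop
      (nhds (s ^ (-α) * ∑ k, N k ^ α)) := by
    intro s hs0
    simp_rw [Finset.sum_div, Finset.mul_sum]
    exact tendsto_finsetSum _ fun k _ => T1 s hs0 k
  -- pairs
  let D : ℝ → Set Ω := fun y => ⋃ p ∈ (Finset.univ : Finset (Fin n)).offDiag,
    {ω | y < Y p.1 ω ∧ y < Y p.2 ω}
  have hDm : ∀ y, MeasurableSet (D y) := fun y =>
    Finset.measurableSet_biUnion _ fun p _ =>
      (measurableSet_lt measurable_const (hYm _)).inter (measurableSet_lt measurable_const (hYm _))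
  have TD : ∀ η : ℝ, 0 < η → Tendsto (fun x => P.real (D (η * x)) / F x) atTop (nhds 0) := by
    intro η hη
    have Tp : ∀ p ∈ (Finset.univ : Finset (Fin n)).offDiag,
        Tendsto (fun x => P.real {ω | η * x < Y p.1 ω ∧ η * x < Y p.2 ω} / F x) atTop
          (nhds 0) := by
      intro p hp
      have hne : p.1 ≠ p.2 := by simpa using hp
      have Q : Tendsto (fun y => P.real {ω | y < Y p.1 ω ∧ y < Y p.2 ω} / F y) atTop (nhds 0) := by
        rw [Metric.tendsto_atTop]
        intro ε hε
        obtain ⟨x₀, h⟩ := hU (ε/2) (by positivity)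
        refine ⟨max x₀ 1, fun x hx => ?_⟩
        have hF := hFpos x (lt_of_lt_of_le one_pos ((le_max_right _ _).trans hx))
        have := h x ((le_max_left _ _).trans hx) _ _ hne
        rw [Real.dist_0_eq_abs, abs_of_nonneg (by positivity), div_lt_iff₀ hF]
        nlinarith
      have hη' : Tendsto (fun x : ℝ => η * x) atTop atTop := tendsto_id.const_mul_atTop hη
      have := (Q.comp hη').mul (hRV η hη)
      rw [zero_mul] at this
      refine this.congr' ?_
      filter_upwards [eventually_gt_atTop 0] with x hx
      have := (hFpos (η * x) (by positivity)).ne'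
      simp only [Function.comp]
      field_simp
    have Ts := tendsto_finsetSum _ Tp
    simp only [Finset.sum_const_zero] at Ts
    refine squeeze_zero' ?_ ?_ Ts
    · filter_upwards [eventually_gt_atTop 0] with x hx
      have := hFpos x hx
      positivity
    · filter_upwards [eventually_gt_atTop 0] with x hx
      have := hFpos x hx
      rw [← Finset.sum_div]
      gcongr
      exact measureReal_biUnion_finset_le _ _
  set c : ℝ := ∑ k, N k + 1 with hc
  have hc0 : 0 < c := by have := Finset.sum_nonneg fun k (_ : k ∈ Finset.univ) => hN0 k; linarith
  have hNc : ∀ k, N k ≤ c := fun k => by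
    have := Finset.single_le_sum (fun k _ => hN0 k) (Finset.mem_univ k)
    linarith
  have hbig : ∀ δ x ω i, δ * x / n < N i * Y i ω → δ / (n * c) * x < Y i ω := by
    intro δ x ω i h
    have h1 : δ * x / n < c * Y i ω := h.trans_le (mul_le_mul_of_nonneg_right (hNc i) (hY0 i ω))
    have h2 : δ / (n * c) * x = (δ * x / n) / c := by field_simp
    rw [h2, div_lt_iff₀ hc0, mul_comm (Y i ω)]
    exact h1
  have hDmem : ∀ δ x ω i j, i ≠ j → δ * x / n < N i * Y i ω → δ * x / n < N j * Y j ω →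
      ω ∈ D (δ / (n * c) * x) := by
    intro δ x ω i j hij h1 h2
    simp only [D, Set.mem_iUnion]
    exact ⟨(i, j), by simpa using hij, hbig _ _ _ _ h1, hbig _ _ _ _ h2⟩
  have upper : ∀ δ : ℝ, 0 < δ → ∀ x > 0,
      P.real {ω | x < nn (fun i => ∑ j, a i j * Y j ω)} ≤
        ∑ k, P.real {ω | (1 - δ) * x < N k * Y k ω} + P.real (D (δ / (n * c) * x)) := by
    intro δ hδ x hx
    have hsub : {ω | x < nn (fun i => ∑ j, a i j * Y j ω)} ⊆
        (⋃ k ∈ (Finset.univ : Finset (Fin n)), {ω | (1 - δ) * x < N k * Y k ω}) ∪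
          D (δ / (n * c) * x) := by
      intro ω hω
      by_cases hk : ∃ k, (1 - δ) * x < N k * Y k ω
      · left; simpa using hk
      · right
        push Not at hk
        have h1 : x < ∑ k, N k * Y k ω := by
          refine lt_of_lt_of_le hω ?_
          rw [nn_eq_sum]
          refine (nn_sum_le ht hs a (fun j => Y j ω) _).trans (le_of_eq ?_)
          refine Finset.sum_congr rfl fun k _ => ?_
          rw [abs_of_nonneg (hY0 k ω), mul_comm]
        obtain ⟨i, j, hij, h2, h3⟩ := det_upper hn (fun k => N k * Y k ω)
          (fun k => mul_nonneg (hN0 k) (hY0 k ω)) x δ (by positivity) h1 hk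
        exact hDmem _ _ _ _ _ hij h2 h3
    refine (measureReal_mono hsub).trans ((measureReal_union_le _ _).trans ?_)
    gcongr
    exact measureReal_biUnion_finset_le _ _
  have lower : ∀ δ : ℝ, 0 < δ → ∀ x > 0,
      ∑ k, P.real {ω | (1 + δ) * x < N k * Y k ω} ≤
      P.real {ω | x < nn (fun i => ∑ j, a i j * Y j ω)} + n * P.real (D (δ / (n * c) * x)) := by
    intro δ hδ x hx
    set E : Fin n → Set Ω := fun k => {ω | (1 + δ) * x < N k * Y k ω} with hE
    set D' := D (δ / (n * c) * x) with hD'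
    have hsm : δ * x / n ≤ (1 + δ) * x := by
      rw [div_le_iff₀ hn']
      have : 0 < δ * x := by positivity
      nlinarith
    have hEm : ∀ k, MeasurableSet (E k) := fun k =>
      measurableSet_lt measurable_const ((hYm k).const_mul _)
    have h1 : ∀ k, P.real (E k) ≤ P.real (E k \ D') + P.real D' := fun k =>
      (measureReal_mono (by intro ω h; by_cases h' : ω ∈ D' <;> simp [h, h'])).trans
        (measureReal_union_le _ _)
    have hdisj : Set.PairwiseDisjoint (↑(Finset.univ : Finset (Fin n))) (fun k => E k \ D') := by
      intro i _ j _ hij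
      refine Set.disjoint_left.2 ?_
      rintro ω ⟨h2, h3⟩ ⟨h4, -⟩
      exact h3 (hDmem _ _ _ _ _ hij (hsm.trans_lt h2) (hsm.trans_lt h4))
    have h2 := measureReal_biUnion_finset (μ := P) hdisj (fun k _ => (hEm k).diff (hDm _))
    have h3 : (⋃ k ∈ (Finset.univ : Finset (Fin n)), E k \ D') ⊆
        {ω | x < nn (fun i => ∑ j, a i j * Y j ω)} := by
      intro ω hω
      simp only [Set.mem_iUnion] at hω
      obtain ⟨k, -, hk, hkD⟩ := hω
      have h4 := nn_sum_ge ht hs a (fun j => Y j ω) k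
      have h5 : ∑ j ∈ Finset.univ.erase k, |Y j ω| * nn (fun i => a i j) ≤ δ * x := by
        have h6 : ∀ j ∈ Finset.univ.erase k, |Y j ω| * nn (fun i => a i j) ≤ δ * x / n := by
          intro j hj
          by_contra! h7
          rw [abs_of_nonneg (hY0 j ω), mul_comm (Y j ω)] at h7
          exact hkD (hDmem _ _ _ _ _ (Finset.ne_of_mem_erase hj) h7 (hsm.trans_lt hk))
        have h7 := Finset.sum_le_sum h6
        rw [Finset.sum_const, nsmul_eq_mul] at h7
        have h8 : ((Finset.univ.erase k).card : ℝ) ≤ n := by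
          exact_mod_cast (Finset.card_le_univ _).trans (by simp)
        have h9 : n * (δ * x / n) = δ * x := by field_simp
        have h10 : 0 ≤ δ * x / n := by positivity
        nlinarith
      have hk' : (1 + δ) * x < N k * Y k ω := hk
      rw [abs_of_nonneg (hY0 k ω), mul_comm] at h4
      simp only [Set.mem_ofPred_eq]
      have : N k * Y k ω ≤ nn (fun i => ∑ j, a i j * Y j ω) + δ * x := h4.trans (by gcongr)
      linarith
    calc ∑ k, P.real (E k) ≤ ∑ k, (P.real (E k \ D') + P.real D') :=
          Finset.sum_le_sum fun k _ => h1 k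
      _ = P.real (⋃ k ∈ (Finset.univ : Finset (Fin n)), E k \ D') + n * P.real D' := by
          rw [h2, Finset.sum_add_distrib]; simp
      _ ≤ _ := by exact add_le_add (measureReal_mono h3 (measure_ne_top _ _)) le_rfl
  set L := ∑ k, N k ^ α with hL
  have hcont : ContinuousAt (fun s : ℝ => s ^ (-α) * L) 1 :=
    (Real.continuousAt_rpow_const _ _ (Or.inl one_ne_zero)).mul continuousAt_const
  have hc1 : Tendsto (fun s : ℝ => s ^ (-α) * L) (nhds 1) (nhds L) := by
    simpa [ContinuousAt] using hcont
  rw [tendsto_order]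
  constructor
  · intro b hb
    have hc2 : Tendsto (fun δ : ℝ => 1 + δ) (nhdsWithin 0 (Set.Ioi 0)) (nhds 1) := by
      have : Tendsto (fun δ : ℝ => 1 + δ) (nhds 0) (nhds (1 + 0)) := by
        exact tendsto_const_nhds.add tendsto_id
      rw [add_zero] at this
      exact this.mono_left nhdsWithin_le_nhds
    obtain ⟨δ, hδb, hδ⟩ := (((hc1.comp hc2).eventually (lt_mem_nhds hb)).and
      self_mem_nhdsWithin).exists
    have hδ : 0 < δ := hδ
    have hlim := (T (1 + δ) (by linarith)).sub ((TD (δ / (n * c)) (by positivity)).const_mul (n:ℝ))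
    rw [mul_zero, sub_zero] at hlim
    filter_upwards [hlim.eventually (lt_mem_nhds hδb), eventually_gt_atTop 0] with x hx hx0
    refine hx.trans_le ?_
    have hF := hFpos x hx0
    rw [← mul_div_assoc, ← sub_div]
    gcongr
    have := lower δ hδ x hx0
    linarith
  · intro b hb
    have hc2 : Tendsto (fun δ : ℝ => 1 - δ) (nhdsWithin 0 (Set.Ioi 0)) (nhds 1) := by
      have : Tendsto (fun δ : ℝ => 1 - δ) (nhds 0) (nhds (1 - 0)) := by
        exact tendsto_const_nhds.sub tendsto_id
      rw [sub_zero] at this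
      exact this.mono_left nhdsWithin_le_nhds
    obtain ⟨δ, ⟨hδb, hδ1⟩, hδ⟩ := ((((hc1.comp hc2).eventually (gt_mem_nhds hb)).and
      (hc2.eventually (lt_mem_nhds one_pos))).and self_mem_nhdsWithin).exists
    have hδ : 0 < δ := hδ
    have hlim := (T (1 - δ) hδ1).add (TD (δ / (n * c)) (by positivity))
    rw [add_zero] at hlim
    filter_upwards [hlim.eventually (gt_mem_nhds hδb), eventually_gt_atTop 0] with x hx hx0
    refine lt_of_le_of_lt ?_ hx
    have hF := hFpos x hx0
    rw [← add_div]
    gcongr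
    exact upper δ hδ x hx0

/-- Multivariate Breiman lemma for a fixed size `n`: if `(X i)` are identically
distributed nonnegative, `X 1` regularly varying with index `α > 0`, uniformly asymptotically
independent, and `A` is a random nonnegative `n × n` matrix, independent of `(X 1, …, X n)`, with
`E[‖A‖^(α+ε)] < ∞` for some `ε > 0` (`‖A‖` the operator norm induced by `nn`), then
`P(nn (A·(X 1, …, X n)) > x) / P(X 1 > x) → E[∑_{k=1}^n nn(A_k)^α]`, `A_k` the `k`-th column. -/
theorem fixed_size_matrix_product_tail
    {Ω : Type*} [MeasurableSpace Ω] (P : Measure Ω) [IsProbabilityMeasure P]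
    (X : ℕ → Ω → ℝ) (hXmeas : ∀ i, Measurable (X i))
    (hXnonneg : ∀ i ω, 0 ≤ X i ω)
    (hXid : ∀ i, 1 ≤ i → IdentDistrib (X i) (X 1) P P)
    (α : ℝ) (hα : 0 < α)
    (hRVpos : ∀ x : ℝ, 0 < x → 0 < P {ω | x < X 1 ω})
    (hRV : ∀ t : ℝ, 0 < t →
      Tendsto (fun x => (P {ω | t * x < X 1 ω}).toReal / (P {ω | x < X 1 ω}).toReal)
        atTop (nhds (t ^ (-α))))
    (hUAI : ∀ ε : ℝ, 0 < ε → ∃ x₀ : ℝ, ∀ x ≥ x₀, ∀ i j : ℕ, 1 ≤ i → 1 ≤ j → i ≠ j →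
      (P {ω | x < X i ω ∧ x < X j ω}).toReal ≤ ε * (P {ω | x < X 1 ω}).toReal)
    (n : ℕ) (hn : 1 ≤ n)
    (nn : (Fin n → ℝ) → ℝ)
    (hnn_tri : ∀ u v, nn (u + v) ≤ nn u + nn v)
    (hnn_smul : ∀ (c : ℝ) u, nn (c • u) = |c| * nn u)
    (hnn_zero : ∀ u, nn u = 0 → u = 0)
    (hnn_lower : ∀ u, ∀ i, |u i| ≤ nn u)
    (hnn_upper : ∀ u, nn u ≤ ∑ i, |u i|)
    (A : Ω → Fin n → Fin n → ℝ) (hAmeas : Measurable A)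
    (hAnonneg : ∀ ω i j, 0 ≤ A ω i j)
    (hAindep : IndepFun A (fun ω => fun i : Fin n => X ((i : ℕ) + 1) ω) P)
    (hAmom : ∃ ε : ℝ, 0 < ε ∧
      ∫⁻ ω, ENNReal.ofReal (inducedOpNorm nn (A ω) ^ (α + ε)) ∂P < ⊤) :
    Tendsto (fun x =>
        (P {ω | x < nn (fun i => ∑ j, A ω i j * X ((j : ℕ) + 1) ω)}).toReal
          / (P {ω | x < X 1 ω}).toReal)
      atTop (nhds (∫ ω, ∑ k : Fin n, nn (fun i => A ω i k) ^ α ∂P)) := by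
  obtain ⟨ε, hε, hmom⟩ := hAmom
  set F : ℝ → ℝ := fun x => P.real {ω | x < X 1 ω} with hF
  set Y : Fin n → Ω → ℝ := fun k => X ((k : ℕ) + 1) with hY
  have hYm : ∀ k, Measurable (Y k) := fun k => hXmeas _
  have hY0 : ∀ k ω, 0 ≤ Y k ω := fun k ω => hXnonneg _ _
  have hYF : ∀ k x, P.real {ω | x < Y k ω} = F x := fun k x => by
    have := (hXid ((k:ℕ)+1) (by omega)).measure_mem_eq (measurableSet_Ioi (a := x))
    exact congrArg ENNReal.toReal this
  have hFpos : ∀ x, 0 < x → 0 < F x := fun x hx =>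
    ENNReal.toReal_pos (hRVpos x hx).ne' (measure_ne_top _ _)
  have hFanti : Antitone F := fun x y hxy =>
    measureReal_mono fun ω (h : y < X 1 ω) => lt_of_le_of_lt hxy h
  obtain ⟨C, x₀, hC, hx₀, hpot⟩ := potter_aux F hFanti hFpos (fun x => measureReal_le_one)
    α (α + ε) hα (by linarith) (hRV (1/2) (by norm_num))
  have hnnc := nn_cont hnn_tri hnn_upper
  have hnn0 := nn_nonneg' hnn_tri hnn_smul
  have hn' : (0:ℝ) < n := by exact_mod_cast hn
  set g : (Fin n → Fin n → ℝ) → (Fin n → ℝ) → ℝ := fun a y => nn (fun i => ∑ j, a i j * y j) with hg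
  have hgc : Continuous (fun p : (Fin n → Fin n → ℝ) × (Fin n → ℝ) => g p.1 p.2) := by
    refine hnnc.comp ?_
    fun_prop
  set V : Ω → Fin n → ℝ := fun ω i => Y i ω with hV
  have hVm : Measurable V := measurable_pi_lambda _ fun i => hYm i
  have hSm : ∀ x : ℝ, MeasurableSet {p : (Fin n → Fin n → ℝ) × (Fin n → ℝ) | x < g p.1 p.2} :=
    fun x => measurableSet_lt measurable_const hgc.measurable
  have hmeas1 : ∀ x : ℝ, Measurable fun a : Fin n → Fin n → ℝ => P {ω' | x < g a (V ω')} := by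
    intro x
    have := measurable_measure_prodMk_left (ν := P.map V) (hSm x)
    convert this using 1
    funext a
    rw [Measure.map_apply hVm (measurable_prodMk_left (hSm x))]
    rfl
  have hfub : ∀ x : ℝ, P.real {ω | x < g (A ω) (V ω)} =
      ∫ ω, P.real {ω' | x < g (A ω) (V ω')} ∂P := by
    intro x
    have h1 := (indepFun_iff_map_prod_eq_prod_map_map hAmeas.aemeasurable hVm.aemeasurable).1 hAindep
    have h2 : P {ω | x < g (A ω) (V ω)} = ∫⁻ ω, P {ω' | x < g (A ω) (V ω')} ∂P := by
      have h3 : P {ω | x < g (A ω) (V ω)} = P.map (fun ω => (A ω, V ω)) {p | x < g p.1 p.2} := by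
        rw [Measure.map_apply (hAmeas.prodMk hVm) (hSm x)]; rfl
      rw [h3, h1, Measure.prod_apply (hSm x), lintegral_map (measurable_measure_prodMk_left (hSm x)) hAmeas]
      refine lintegral_congr fun ω => ?_
      rw [Measure.map_apply hVm (measurable_prodMk_left (hSm x))]
      rfl
    rw [measureReal_def, h2, ← integral_toReal]
    · rfl
    · exact ((hmeas1 x).comp hAmeas).aemeasurable
    · exact Eventually.of_forall fun ω => measure_lt_top _ _
  have hcolm : ∀ k, Measurable fun ω => nn (fun i => A ω i k) := fun k =>
    hnnc.measurable.comp (by fun_prop)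
  have hint : ∀ k, Integrable (fun ω => nn (fun i => A ω i k) ^ (α + ε)) P := by
    intro k
    refine ⟨((hcolm k).pow_const _).aestronglyMeasurable, ?_⟩
    rw [hasFiniteIntegral_iff_ofReal (Eventually.of_forall fun ω => Real.rpow_nonneg (hnn0 _) _)]
    refine lt_of_le_of_lt (lintegral_mono fun ω => ENNReal.ofReal_le_ofReal ?_) hmom
    exact Real.rpow_le_rpow (hnn0 _)
      (col_le_op hnn_tri hnn_smul hnn_lower hnn_upper (A ω) k) (by positivity)
  have hgoal : Tendsto (fun x => ∫ ω, P.real {ω' | x < g (A ω) (V ω')} / F x ∂P) atTop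
      (nhds (∫ ω, ∑ k : Fin n, nn (fun i => A ω i k) ^ α ∂P)) := by
    refine tendsto_integral_filter_of_dominated_convergence
      (fun ω => ∑ k : Fin n, C * (1 + (n:ℝ) ^ (α + ε) * nn (fun i => A ω i k) ^ (α + ε)))
      ?_ ?_ ?_ ?_
    · refine Eventually.of_forall fun x => Measurable.aestronglyMeasurable ?_
      exact (((hmeas1 x).comp hAmeas).ennreal_toReal).div_const _
    · filter_upwards [eventually_ge_atTop x₀] with x hx
      refine Eventually.of_forall fun ω => ?_
      have hx0 : 0 < x := lt_of_lt_of_le hx₀ hx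
      have hFx := hFpos x hx0
      rw [Real.norm_of_nonneg (by positivity), div_le_iff₀ hFx, Finset.sum_mul]
      have hsub : {ω' | x < g (A ω) (V ω')} ⊆ ⋃ k ∈ (Finset.univ : Finset (Fin n)),
          {ω' | x < n * nn (fun i => A ω i k) * Y k ω'} := by
        intro ω' h
        simp only [Finset.mem_univ, Set.iUnion_true, Set.mem_iUnion, Set.mem_ofPred_eq] at h ⊢
        by_contra! hcon
        have h1 : g (A ω) (V ω') ≤ ∑ k, |V ω' k| * nn (fun i => A ω i k) := by
          simp only [hg]
          rw [nn_eq_sum]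
          exact nn_sum_le hnn_tri hnn_smul (A ω) (V ω') _
        have h2 : ∑ k, |V ω' k| * nn (fun i => A ω i k) ≤ ∑ _k : Fin n, x / n := by
          refine Finset.sum_le_sum fun k _ => ?_
          rw [abs_of_nonneg (hY0 k ω'), le_div_iff₀ hn']
          have := hcon k
          change Y k ω' * _ * _ ≤ x
          linarith
        have h3 : ∑ _k : Fin n, x / n = x := by
          simp; field_simp
        linarith
      refine (measureReal_mono hsub (measure_ne_top _ _)).trans ((measureReal_biUnion_finset_le _ _).trans ?_)
      refine Finset.sum_le_sum fun k _ => ?_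
      rcases (hnn0 (fun i => A ω i k)).eq_or_lt with h0 | h0
      · rw [← h0]
        have : ¬ x < 0 := not_lt.2 hx0.le
        simp only [mul_zero, zero_mul, this, Set.ofPred_false, measureReal_empty]
        have := Real.rpow_nonneg (le_refl (0:ℝ)) (α + ε)
        positivity
      · have h1 := hpot x hx (n * nn (fun i => A ω i k)) (by positivity)
        rw [Real.mul_rpow hn'.le h0.le] at h1
        refine le_trans (le_of_eq ?_) h1
        rw [← hYF k]
        congr 1
        ext ω'
        simp only [Set.mem_ofPred_eq]
        rw [div_lt_iff₀ (by positivity), mul_comm (Y k ω')]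
    · exact integrable_finsetSum _ fun k _ =>
        ((integrable_const _).add ((hint k).const_mul _)).const_mul _
    · refine Eventually.of_forall fun ω => ?_
      refine pointwise_tail P hn nn hnn_tri hnn_smul F hFpos α hα hRV Y hYm hY0 hYF ?_ (A ω)
      intro e he
      obtain ⟨y₀, h⟩ := hUAI e he
      refine ⟨y₀, fun x hx i j hij => h x hx _ _ (by omega) (by omega) ?_⟩
      intro h'
      exact hij (Fin.ext (by omega))
  refine hgoal.congr fun x => ?_
  rw [integral_div, ← hfub x]
  rfl
end
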